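/- arXiv:1908.06511 — 3 statements merged into one kernel-verified Lean document; each statement's English description precedes it below -/
import Mathlib

section
/- Let p be a prime with p > 5 such that p % 8 ∈ {3, 5} and p % 10 ∈ {3, 7} (i.e., p ≡ ±3 mod 8 and p ≡ ±3 mod 10). Then PSL(2,p) satisfies the replacement property. -/
section Defs

variable {G : Type*} [Group G]

/-- `g` is a generating sequence of `G`: the set of its entries generates `G`. -/
def IsGenSeq {n : ℕ} (g : Fin n → G) : Prop :=
  Subgroup.closure (Set.range g) = ⊤

/-- `g` is irredundant: for each `i`, the entries other than `g i` do not generate `G`. -/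
def IsIrred {n : ℕ} (g : Fin n → G) : Prop :=
  ∀ i : Fin n, Subgroup.closure (g '' {j | j ≠ i}) ≠ ⊤

/-- `m(G)`: the largest length of an irredundant generating sequence of `G`. -/
noncomputable def maxIrredLen (G : Type*) [Group G] : ℕ :=
  sSup {n | ∃ g : Fin n → G, IsGenSeq g ∧ IsIrred g}

/-- `G` satisfies the replacement property. -/
def ReplacementProperty (G : Type*) [Group G] : Prop :=
  ∀ g : Fin (maxIrredLen G) → G, IsGenSeq g → IsIrred g →
    ∀ x : G, x ≠ 1 → ∃ i, IsGenSeq (Function.update g i x)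

/-- `x` is a witness to failure of the replacement property for `G`. -/
def IsWitnessToFailure {G : Type*} [Group G] (x : G) : Prop :=
  x ≠ 1 ∧ ∃ g : Fin (maxIrredLen G) → G, IsGenSeq g ∧ IsIrred g ∧
    ∀ i, ¬ IsGenSeq (Function.update g i x)

/-- A family of subgroups is in general position. -/
def InGeneralPosition {n : ℕ} (H : Fin n → Subgroup G) : Prop :=
  ∀ j, ¬ ((⨅ i ∈ ({j}ᶜ : Set (Fin n)), H i) ≤ H j)

/-- The sequence of subgroups `M` corresponds to the sequence of elements `g`. -/
def Corresponds {n : ℕ} (M : Fin n → Subgroup G) (g : Fin n → G) : Prop :=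
  (∀ i j, j ≠ i → g i ∈ M j) ∧ ∀ i, g i ∉ M i

end Defs

/-- `PSL(2,p)`. -/
abbrev PSL (p : ℕ) : Type := Matrix.ProjectiveSpecialLinearGroup (Fin 2) (ZMod p)

section Proof

open MulAction
open scoped Pointwise

theorem MulAction.mem_stabilizer_pair {G Ω : Type*} [Group G] [MulAction G Ω] {g : G} {a b : Ω} :
    g ∈ MulAction.stabilizer G ({a, b} : Set Ω) ↔
      (g • a = a ∧ g • b = b) ∨ (g • a = b ∧ g • b = a) := by
  rw [MulAction.mem_stabilizer_iff, Set.smul_set_insert, Set.smul_set_singleton,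
    Set.pair_eq_pair_iff]

/-- If three orbits of sizes `f i ≥ 3` with point stabilizers of order `s i ≥ 2` cover `n + 2`
points of a group of order `n`, then `n = 12` or some stabilizer has order 4 or 5. -/
theorem orbit_equation {n f₁ f₂ f₃ s₁ s₂ s₃ : ℕ} (e₁ : f₁ * s₁ = n) (e₂ : f₂ * s₂ = n)
    (e₃ : f₃ * s₃ = n) (t₁ : 2 ≤ s₁) (t₂ : 2 ≤ s₂) (t₃ : 2 ≤ s₃) (u₃ : 3 ≤ f₃) (h : f₁ + f₂ + f₃ = n + 2) (h₁₂ : s₁ ≤ s₂) (h₂₃ : s₂ ≤ s₃) :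
    n = 12 ∨ s₃ = 4 ∨ s₃ = 5 := by
  have hs₁ : s₁ < 3 := by
    by_contra! hs
    nlinarith
  obtain rfl : s₁ = 2 := by omega
  have hs₂ : s₂ < 4 := by
    by_contra! hs
    nlinarith
  interval_cases s₂
  · omega
  · have hs₃ : s₃ < 6 := by
      by_contra! hs
      nlinarith
    interval_cases s₃ <;> omega

theorem orbit_equation_unordered {n : ℕ} (f s : Fin 3 → ℕ) (e : ∀ i, f i * s i = n)
    (t : ∀ i, 2 ≤ s i) (u : ∀ i, 3 ≤ f i) (h : ∑ i, f i = n + 2) :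
    n = 12 ∨ ∃ i, s i = 4 ∨ s i = 5 := by
  rw [Fin.sum_univ_three] at h
  have key : ∀ i j k, f i + f j + f k = n + 2 → s i ≤ s j → s j ≤ s k →
      n = 12 ∨ ∃ i, s i = 4 ∨ s i = 5 := fun i j k hs hij hjk ↦
    (orbit_equation (e i) (e j) (e k) (t i) (t j) (t k) (u k) hs hij hjk).imp_right
      fun h ↦ ⟨k, h⟩
  rcases le_total (s 0) (s 1) with a | a <;> rcases le_total (s 1) (s 2) with b | b <;>
    rcases le_total (s 0) (s 2) with c | c
  · exact key 0 1 2 (by omega) a b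
  · exact key 0 1 2 (by omega) a b
  · exact key 0 2 1 (by omega) c b
  · exact key 2 0 1 (by omega) c a
  · exact key 1 0 2 (by omega) a c
  · exact key 1 2 0 (by omega) b c
  · exact key 2 1 0 (by omega) b a
  · exact key 2 1 0 (by omega) b a

open MulAction in
/-- A finite group whose nontrivial elements fix exactly two points each, and which preserves no
set of at most two points, has order 12 or a point stabilizer of order 4 or 5. -/
theorem card_eq_twelve_or_exists_card_stabilizer {H Ω : Type*} [Group H] [Finite H]
    [Nontrivial H] [MulAction H Ω]
    (hfix : ∀ h : H, h ≠ 1 → ∃ a b, a ≠ b ∧ fixedBy Ω h = {a, b})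
    (hpair : ∀ a b : Ω, stabilizer H ({a, b} : Set Ω) ≠ ⊤) :
    Nat.card H = 12 ∨
      ∃ a : Ω, Nat.card (stabilizer H a) = 4 ∨ Nat.card (stabilizer H a) = 5 := by
  classical
  cases nonempty_fintype H
  let P : SubMulAction H Ω :=
    { carrier := {a | stabilizer H a ≠ ⊥}
      smul_mem' := fun h a ha hb ↦ ha <| by
        rw [stabilizer_smul_eq_stabilizer_map_conj] at hb
        exact (Subgroup.map_eq_bot_iff_of_injective _ (MulAut.conj h).injective).1 hb }
  have hmemP : ∀ a, a ∈ P ↔ ∃ h : H, h ≠ 1 ∧ h • a = a := fun a ↦ by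
    change stabilizer H a ≠ ⊥ ↔ _
    simp only [ne_eq, Subgroup.eq_bot_iff_forall, mem_stabilizer_iff]
    push Not
    exact exists_congr fun h ↦ and_comm
  have hPfin : (P : Set Ω).Finite := by
    refine (Set.finite_iUnion fun h : {h : H // h ≠ 1} ↦
      (show (fixedBy Ω (h : H)).Finite from ?_)).subset fun a ha ↦ ?_
    · obtain ⟨a, b, -, hab⟩ := hfix h h.2
      simp [hab]
    · obtain ⟨h, h1, ha⟩ := (hmemP a).1 ha
      exact Set.mem_iUnion.2 ⟨⟨h, h1⟩, ha⟩
  have : Fintype P := hPfin.fintype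
  have hfixP : ∀ h : H, h ≠ 1 → Fintype.card (fixedBy P h) = 2 := fun h h1 ↦ by
    obtain ⟨a, b, hab, hF⟩ := hfix h h1
    have hm : ∀ c, c ∈ fixedBy Ω h ↔ c = a ∨ c = b := by simp [hF]
    have ha : a ∈ P := (hmemP a).2 ⟨h, h1, (hm a).2 (.inl rfl)⟩
    have hb : b ∈ P := (hmemP b).2 ⟨h, h1, (hm b).2 (.inr rfl)⟩
    have : fixedBy P h = {⟨a, ha⟩, ⟨b, hb⟩} := by
      ext c
      simpa [Subtype.ext_iff] using hm c
    rw [← Nat.card_eq_fintype_card, Nat.card_coe_set_eq, this, Set.ncard_pair]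
    simpa using hab
  have hburn := sum_card_fixedBy_eq_card_orbits_mul_card_group H P
  rw [← Finset.add_sum_erase _ _ (Finset.mem_univ (1 : H)),
    Finset.sum_congr rfl (fun h hh ↦ hfixP h (Finset.ne_of_mem_erase hh))] at hburn
  have hone : Fintype.card (fixedBy P (1 : H)) = Fintype.card P := by simp
  have hsum : Fintype.card P =
      ∑ ω : Quotient (orbitRel H P), Fintype.card (orbit H ω.out) := by
    rw [← Fintype.card_sigma]
    exact Fintype.card_congr (selfEquivSigmaOrbits H P)
  rw [hone, Finset.sum_const, Finset.card_erase_of_mem (Finset.mem_univ _), Finset.card_univ,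
    smul_eq_mul, hsum] at hburn
  have hn : 2 ≤ Fintype.card H := Fintype.one_lt_card
  set n := Fintype.card H
  set f : Quotient (orbitRel H P) → ℕ := fun ω ↦ Fintype.card (orbit H ω.out) with hf
  set s : Quotient (orbitRel H P) → ℕ := fun ω ↦ Fintype.card (stabilizer H ω.out) with hs
  have hfs : ∀ ω, f ω * s ω = n := fun ω ↦ card_orbit_mul_card_stabilizer_eq_card_group H ω.out
  have hstab : ∀ a : P, stabilizer H (a : Ω) = stabilizer H a := fun a ↦ by
    ext; simp [Subtype.ext_iff]
  have hs2 : ∀ ω, 2 ≤ s ω := fun ω ↦ by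
    have : stabilizer H ω.out ≠ ⊥ := by
      rw [← hstab]
      exact ω.out.2
    have := (Subgroup.nontrivial_iff_ne_bot _).2 this
    exact Fintype.one_lt_card
  have hf3 : ∀ ω, 3 ≤ f ω := fun ω ↦ by
    by_contra! hlt
    have hinv : ∀ a b : P, orbit H ω.out ≠ {a, b} := fun a b hab ↦ by
      refine hpair a b (eq_top_iff.2 fun h _ ↦ ?_)
      have h1 : h • ({a, b} : Set P) = {a, b} := by rw [← hab, smul_orbit]
      rw [Set.smul_set_insert, Set.smul_set_singleton, Set.pair_eq_pair_iff] at h1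
      rw [mem_stabilizer_pair]
      simpa [Subtype.ext_iff] using h1
    have hpos : 0 < f ω := Fintype.card_pos_iff.2 ⟨⟨_, mem_orbit_self _⟩⟩
    have hcard : (orbit H ω.out).ncard = f ω := by
      rw [← Nat.card_coe_set_eq, Nat.card_eq_fintype_card]
    obtain h1 | h2 : f ω = 1 ∨ f ω = 2 := by omega
    · obtain ⟨a, ha⟩ := Set.ncard_eq_one.1 (hcard.trans h1)
      exact hinv a a (by simp [ha])
    · obtain ⟨a, b, -, hab⟩ := Set.ncard_eq_two.1 (hcard.trans h2)
      exact hinv a b hab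
  set k := Fintype.card (Quotient (orbitRel H P)) with hk
  have hle : 3 * k ≤ ∑ ω, f ω := by
    have := Finset.card_nsmul_le_sum Finset.univ f 3 fun ω _ ↦ hf3 ω
    simpa [mul_comm, hk] using this
  have hge : 2 * ∑ ω, f ω ≤ k * n := by
    have := Finset.sum_le_card_nsmul Finset.univ (fun ω ↦ 2 * f ω) n fun ω _ ↦ by
      change 2 * f ω ≤ n
      rw [← hfs ω, mul_comm]
      exact Nat.mul_le_mul_left _ (hs2 ω)
    simpa [Finset.mul_sum, hk] using this
  replace hburn : ∑ ω, f ω + (n - 1) * 2 = k * n := hburn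
  have hk4 : k < 4 := by
    by_contra! h4
    have := Nat.mul_le_mul_right n h4
    omega
  have hk3 : k = 3 := by
    interval_cases k <;> omega
  obtain ⟨e⟩ : Nonempty (Fin 3 ≃ Quotient (orbitRel H P)) :=
    ⟨(Fintype.equivFinOfCardEq hk3).symm⟩
  have := orbit_equation_unordered (f ∘ e) (s ∘ e) (fun i ↦ hfs _) (fun i ↦ hs2 _)
    (fun i ↦ hf3 _) (n := n) (by
      have := Equiv.sum_comp e f
      simp only [Function.comp_apply, this]
      rw [hk3] at hburn
      omega)
  rw [Nat.card_eq_fintype_card]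
  refine this.imp_right ?_
  rintro ⟨i, hi⟩
  refine ⟨(e i).out, ?_⟩
  rw [hstab, Nat.card_eq_fintype_card]
  exact hi

section IndexTwo

variable {G : Type*} [Group G] {A H : Subgroup G}

theorem Subgroup.relIndex_eq_two_of_card (hAH : A ≤ H) (hA : Nat.card A ≠ 0)
    (hc : Nat.card H = 2 * Nat.card A) : A.relIndex H = 2 := by
  have h := Subgroup.relIndex_mul_relIndex ⊥ A H bot_le hAH
  rw [Subgroup.relIndex_bot_left, Subgroup.relIndex_bot_left, hc, mul_comm] at h
  exact Nat.eq_of_mul_eq_mul_right (Nat.pos_of_ne_zero hA) h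

theorem Subgroup.sq_mem_of_relIndex_two (h : A.relIndex H = 2) {g : G} (hg : g ∈ H) :
    g ^ 2 ∈ A :=
  Subgroup.sq_mem_of_index_two (H := A.subgroupOf H) h ⟨g, hg⟩

theorem Subgroup.conj_mem_of_relIndex_two (h : A.relIndex H = 2) (hAH : A ≤ H) {a g : G}
    (hg : g ∈ H) (ha : a ∈ A) : g * a * g⁻¹ ∈ A :=
  (Subgroup.normal_of_index_eq_two (H := A.subgroupOf H) h).conj_mem ⟨a, hAH ha⟩ ha ⟨g, hg⟩

/-- A group of order 12 with a subgroup of order 6 has a normal subgroup of order 3. -/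
theorem exists_conj_mem_zpowers_of_card_six (hAH : A ≤ H) (hA : Nat.card A = 6)
    (hH : Nat.card H = 12) :
    ∃ t ∈ H, t ≠ 1 ∧ ∀ h ∈ H, h * t * h⁻¹ ∈ Subgroup.zpowers t := by
  have : Finite A := Nat.finite_of_card_ne_zero (by omega)
  have : Fact (Nat.Prime 3) := ⟨Nat.prime_three⟩
  obtain ⟨t, ht⟩ := exists_prime_orderOf_dvd_card' (G := A) 3 (by omega)
  rw [← Subgroup.orderOf_coe] at ht
  have h2 : A.relIndex H = 2 := Subgroup.relIndex_eq_two_of_card hAH (by omega) (by omega)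
  have hzA : Subgroup.zpowers (t : G) ≤ A := by simp
  have hzc : Nat.card (Subgroup.zpowers (t : G)) = 3 := by rw [Nat.card_zpowers, ht]
  have hz : (Subgroup.zpowers (t : G)).relIndex A = 2 :=
    Subgroup.relIndex_eq_two_of_card hzA (by omega) (by omega)
  refine ⟨t, hAH t.2, fun h1 ↦ by simp [h1] at ht, fun h hh ↦ ?_⟩
  have hsq := Subgroup.sq_mem_of_relIndex_two hz
    (Subgroup.conj_mem_of_relIndex_two h2 hAH hh (A.pow_mem t.2 2))
  have ht4 : ((t : G) ^ 2) ^ 2 = t := by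
    rw [← pow_mul, pow_succ, ← ht, pow_orderOf_eq_one, one_mul]
  rwa [conj_pow, ht4] at hsq

/-- A group of order 12 with two incomparable subgroups meeting nontrivially has a nontrivial
normal cyclic subgroup. -/
theorem exists_conj_mem_zpowers_of_card_twelve {B X : Subgroup G} (hH : Nat.card H = 12)
    (hX : X ≠ ⊥) (hXA : X < A) (hXB : X < B) (hAH : A < H) (hBH : B < H) (hsup : A ⊔ B = H) :
    ∃ t ∈ H, t ≠ 1 ∧ ∀ h ∈ H, h * t * h⁻¹ ∈ Subgroup.zpowers t := by
  by_cases hA6 : Nat.card A = 6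
  · exact exists_conj_mem_zpowers_of_card_six hAH.le hA6 hH
  by_cases hB6 : Nat.card B = 6
  · exact exists_conj_mem_zpowers_of_card_six hBH.le hB6 hH
  have : Finite H := Nat.finite_of_card_ne_zero (by omega)
  have hfin : ∀ {K : Subgroup G}, K < H → Finite K := fun h ↦
    Finite.of_injective _ (Subgroup.inclusion_injective h.le)
  have hX1 : 1 < Nat.card X := by
    have := hfin (hXA.trans hAH)
    exact X.one_lt_card_iff_ne_bot.2 hX
  have hcard : ∀ {K : Subgroup G}, X < K → K < H → Nat.card K ≠ 6 →
      Nat.card K = 4 ∧ Nat.card X = 2 := by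
    intro K hXK hKH h6
    have := hfin hKH
    have d1 := Subgroup.card_dvd_of_le hXK.le
    have d2 := Subgroup.card_dvd_of_le hKH.le
    have n1 : Nat.card X ≠ Nat.card K := fun h ↦
      hXK.ne (Subgroup.eq_of_le_of_card_ge hXK.le h.ge)
    have n2 : Nat.card K ≠ Nat.card H := fun h ↦
      hKH.ne (Subgroup.eq_of_le_of_card_ge hKH.le h.ge)
    have l2 := Nat.le_of_dvd (by omega) d2
    rw [hH] at d2 n2 l2
    have l1 := Nat.le_of_dvd Nat.card_pos d1
    generalize Nat.card K = k at *
    generalize Nat.card X = x at *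
    interval_cases k <;> simp_all <;> interval_cases x <;> simp_all
  obtain ⟨hA4, hX2⟩ := hcard hXA hAH hA6
  obtain ⟨hB4, -⟩ := hcard hXB hBH hB6
  have hAi : X.relIndex A = 2 := Subgroup.relIndex_eq_two_of_card hXA.le (by omega) (by omega)
  have hBi : X.relIndex B = 2 := Subgroup.relIndex_eq_two_of_card hXB.le (by omega) (by omega)
  obtain ⟨x, hx, hx1⟩ := X.bot_or_exists_ne_one.resolve_left hX
  have hXx : Subgroup.zpowers x = X := by
    have := hfin (hXA.trans hAH)
    refine Subgroup.eq_of_le_of_card_ge (by simpa using hx) ?_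
    rw [hX2]
    have : Finite (Subgroup.zpowers x) := Finite.of_injective _
      (Subgroup.inclusion_injective (show Subgroup.zpowers x ≤ X by simpa using hx))
    exact (Subgroup.one_lt_card_iff_ne_bot _).2 (by simpa using hx1)
  have hnorm : H ≤ Subgroup.normalizer (X : Set G) := by
    rw [← hsup]
    exact sup_le
      (Subgroup.le_normalizer_iff.2 fun _ ha _ hb ↦
        Subgroup.conj_mem_of_relIndex_two hAi hXA.le ha hb)
      (Subgroup.le_normalizer_iff.2 fun _ ha _ hb ↦
        Subgroup.conj_mem_of_relIndex_two hBi hXB.le ha hb)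
  exact ⟨x, (hXA.trans hAH).le hx, hx1, fun h hh ↦ by
    rw [hXx]
    exact (Subgroup.mem_normalizer_iff.1 (hnorm hh) x).1 hx⟩

end IndexTwo

/-- The properties of the action of `PSL(2, p)` on a projective line over an algebraically closed
field which, for `p ≡ ±3` modulo `8` and modulo `10`, control its subgroups. -/
structure IsMoebiusAction (G Ω : Type*) [Group G] [MulAction G Ω] : Prop where
  exists_fixedBy_eq : ∀ g : G, g ≠ 1 → ∃ a b, fixedBy Ω g = {a, b}
  mul_self_of_swap : ∀ (g : G) (a b : Ω), a ≠ b → g • a = b → g • b = a → g * g = 1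
  involution_unique : ∀ (g h : G) (a b : Ω), a ≠ b → g ≠ 1 → h ≠ 1 → g * g = 1 → h * h = 1 →
    g • a = a → g • b = b → h • a = a → h • b = b → g = h
  stabilizer_pair_ne_top : ∀ a b : Ω, stabilizer G ({a, b} : Set Ω) ≠ ⊤
  exists_fixedBy_eq_of_ne_top : ∀ H : Subgroup G, H ≠ ⊤ →
    (∀ a : Ω, ¬ H ≤ stabilizer G ({a, a} : Set Ω)) →
    ∀ h ∈ H, h ≠ 1 → ∃ a b, a ≠ b ∧ fixedBy Ω h = {a, b}
  orderOf_ne_four : ∀ g : G, orderOf g ≠ 4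
  orderOf_ne_five : ∀ g : G, orderOf g ≠ 5

namespace IsMoebiusAction

variable {G Ω : Type*} [Group G] [MulAction G Ω]

theorem le_stabilizer_pair_of_conj_mem (hG : IsMoebiusAction G Ω) {H : Subgroup G} {x : G}
    (hx : x ≠ 1) (hconj : ∀ h ∈ H, h * x * h⁻¹ ∈ Subgroup.zpowers x) :
    ∃ a b : Ω, H ≤ stabilizer G ({a, b} : Set Ω) := by
  obtain ⟨a, b, hab⟩ := hG.exists_fixedBy_eq x hx
  have hsub : ∀ h ∈ H, h • ({a, b} : Set Ω) ⊆ {a, b} := by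
    rintro h hh _ ⟨c, hc, rfl⟩
    rw [← hab, mem_fixedBy] at hc ⊢
    have hz : Subgroup.zpowers x ≤ stabilizer G c := by simpa using hc
    have := hz (by simpa using hconj h⁻¹ (H.inv_mem hh))
    rw [mem_stabilizer_iff, mul_smul, mul_smul, inv_smul_eq_iff] at this
    exact this
  refine ⟨a, b, fun h hh ↦ mem_stabilizer_iff.2 ((hsub h hh).antisymm ?_)⟩
  rw [Set.subset_smul_set_iff]
  exact hsub _ (H.inv_mem hh)

/-- Two distinct involutions of a point stabilizer do not commute. -/
theorem card_stabilizer_ne_four (hG : IsMoebiusAction G Ω) {H : Subgroup G}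
    (hfix : ∀ h ∈ H, h ≠ 1 → ∃ a b, a ≠ b ∧ fixedBy Ω h = {a, b}) (c : Ω) :
    Nat.card (stabilizer H c) ≠ 4 := by
  intro h4
  have : Finite (stabilizer H c) := Nat.finite_of_card_ne_zero (by omega)
  have hinv : ∀ g : stabilizer H c, (g : G) * g = 1 := fun g ↦ by
    have hd : orderOf (((g : H) : G)) ∣ 4 := by
      rw [Subgroup.orderOf_coe, Subgroup.orderOf_coe, ← h4]
      exact orderOf_dvd_natCard g
    have : orderOf (((g : H) : G)) ∣ 2 := by
      have h1 := hG.orderOf_ne_four g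
      have h2 := Nat.le_of_dvd (by norm_num) hd
      generalize orderOf ((g : H) : G) = k at *
      interval_cases k <;> omega
    rw [← sq]
    exact orderOf_dvd_iff_pow_eq_one.1 this
  have hexp : ∀ g : stabilizer H c, g * g = 1 := fun g ↦ Subtype.ext (Subtype.ext (hinv g))
  have hone : ∀ g : stabilizer H c, ((g : H) : G) = 1 ↔ g = 1 := by simp
  have hcomm : ∀ g h : stabilizer H c, g * h = h * g := fun g h ↦ by
    have h1 := hexp (g * h)
    have h2 := hexp g
    have h3 := hexp h
    rw [mul_eq_one_iff_eq_inv] at h1 h2 h3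
    rw [h1, mul_inv_rev, ← h2, ← h3]
  have huniq : ∀ g h : stabilizer H c, g ≠ 1 → h ≠ 1 → g = h := by
    intro g h hg hh
    have hg' := mt (hone g).1 hg
    have hh' := mt (hone h).1 hh
    obtain ⟨a, b, hab, hF⟩ := hfix g g.1.2 hg'
    have hm : ∀ d, ((g : H) : G) • d = d ↔ d = a ∨ d = b := fun d ↦ by
      rw [← mem_fixedBy, hF]
      simp
    have key : ∀ a b : Ω, a ≠ b → (∀ d, ((g : H) : G) • d = d ↔ d = a ∨ d = b) → c = a →
        g = h := by
      rintro a b hab hm rfl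
      have hhc : ((h : H) : G) • c = c := h.2
      have hcomm' : ((g : H) : G) * ((h : H) : G) = ((h : H) : G) * ((g : H) : G) :=
        congrArg (fun x : stabilizer H c ↦ ((x : H) : G)) (hcomm g h)
      have hb : ((h : H) : G) • b = b := by
        refine ((hm (((h : H) : G) • b)).1 ?_).resolve_left fun hb ↦ hab ?_
        · rw [← mul_smul, hcomm', mul_smul, (hm b).2 (.inr rfl)]
        · exact (smul_left_cancel _ (hb.trans hhc.symm)).symm
      exact Subtype.ext (Subtype.ext (hG.involution_unique _ _ c b hab hg' hh' (hinv g) (hinv h)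
        ((hm c).2 (.inl rfl)) ((hm b).2 (.inr rfl)) hhc hb))
    rcases (hm c).1 g.2 with hc | hc
    · exact key a b hab hm hc
    · exact key b a hab.symm (fun d ↦ (hm d).trans or_comm) hc
  classical
  cases nonempty_fintype (stabilizer H c)
  have h1 : (Finset.univ.erase (1 : stabilizer H c)).card ≤ 1 :=
    Finset.card_le_one.2 fun g hg h hh ↦
      huniq g h (Finset.ne_of_mem_erase hg) (Finset.ne_of_mem_erase hh)
  rw [Finset.card_erase_of_mem (Finset.mem_univ _), Finset.card_univ,
    ← Nat.card_eq_fintype_card] at h1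
  omega

/-- A proper subgroup preserving no pair of points has order 12. -/
theorem card_eq_twelve [Finite G] (hG : IsMoebiusAction G Ω) {H : Subgroup G} (hH : H ≠ ⊤)
    (hbot : H ≠ ⊥) (hpair : ∀ a b : Ω, ¬ H ≤ stabilizer G ({a, b} : Set Ω)) :
    Nat.card H = 12 := by
  have hfix := hG.exists_fixedBy_eq_of_ne_top H hH fun a ↦ hpair a a
  have := (Subgroup.nontrivial_iff_ne_bot _).2 hbot
  refine (card_eq_twelve_or_exists_card_stabilizer (H := H) (Ω := Ω) (fun h h1 ↦
    hfix h h.2 (by simpa using h1)) fun a b hab ↦ hpair a b fun h hh ↦ ?_).resolve_right ?_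
  · have : (⟨h, hh⟩ : H) ∈ stabilizer H ({a, b} : Set Ω) := by simp [hab]
    exact this
  · rintro ⟨a, h4 | h5⟩
    · exact hG.card_stabilizer_ne_four hfix a h4
    · have : Fact (Nat.Prime 5) := ⟨Nat.prime_five⟩
      obtain ⟨t, ht⟩ := exists_prime_orderOf_dvd_card' (G := stabilizer H a) 5 (by omega)
      exact hG.orderOf_ne_five t (by rwa [Subgroup.orderOf_coe, Subgroup.orderOf_coe])

/-- A proper subgroup generated by two proper subgroups with nontrivial intersection preserves a
pair of points. -/
theorem exists_le_stabilizer_pair [Finite G] (hG : IsMoebiusAction G Ω) {H A B X : Subgroup G}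
    (hH : H ≠ ⊤) (hX : X ≠ ⊥) (hXA : X < A) (hXB : X < B) (hAH : A < H) (hBH : B < H)
    (hsup : A ⊔ B = H) : ∃ a b : Ω, H ≤ stabilizer G ({a, b} : Set Ω) := by
  by_contra! hpair
  obtain ⟨t, -, ht1, ht⟩ := exists_conj_mem_zpowers_of_card_twelve
    (hG.card_eq_twelve hH (ne_bot_of_gt hAH) hpair) hX hXA hXB hAH hBH hsup
  obtain ⟨a, b, hab⟩ := hG.le_stabilizer_pair_of_conj_mem ht1 ht
  exact hpair a b hab

/-- There is no nontrivial subgroup `X` and elements `g 0`, `g 1`, `g 2` which generate `G`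
together with `X`, while no two of them do. -/
theorem exists_sup_closure_eq_top [Finite G] (hG : IsMoebiusAction G Ω) {X : Subgroup G}
    (hX : X ≠ ⊥) (g : Fin 3 → G) (hgen : X ⊔ Subgroup.closure (Set.range g) = ⊤) :
    ∃ i, X ⊔ Subgroup.closure (g '' {j | j ≠ i}) = ⊤ := by
  by_contra! hM
  set M : Fin 3 → Subgroup G := fun i ↦ X ⊔ Subgroup.closure (g '' {j | j ≠ i}) with hMdef
  have hXM : ∀ i, X ≤ M i := fun i ↦ le_sup_left
  have hgM : ∀ i j, i ≠ j → g i ∈ M j := fun i j hij ↦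
    Subgroup.mem_sup_right (Subgroup.subset_closure ⟨i, hij, rfl⟩)
  have htop : ∀ i (K : Subgroup G), M i ≤ K → g i ∈ K → K = ⊤ := fun i K hK hi ↦ by
    rw [eq_top_iff, ← hgen]
    refine sup_le ((hXM i).trans hK) ((Subgroup.closure_le _).2 ?_)
    rintro _ ⟨j, rfl⟩
    obtain rfl | hj := eq_or_ne j i
    · exact hi
    · exact hK (hgM j i hj)
  have hgn : ∀ i, g i ∉ M i := fun i hi ↦ hM i (htop i _ le_rfl hi)
  have hpair : ∀ i, ∃ a b : Ω, M i ≤ stabilizer G ({a, b} : Set Ω) := by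
    intro i
    obtain ⟨j, k, hij, hik, hjk, hcov⟩ : ∃ j k : Fin 3, i ≠ j ∧ i ≠ k ∧ j ≠ k ∧
        ∀ l, l ≠ i → l = j ∨ l = k := by
      revert i; decide
    have hz : ∀ l {K : Subgroup G}, X ⊔ Subgroup.zpowers (g l) ≤ K ↔ X ≤ K ∧ g l ∈ K := by simp
    have hl : ∀ l, g l ∈ X ⊔ Subgroup.zpowers (g l) := fun l ↦ ((hz l).1 le_rfl).2
    have h1 : ∀ l, l ≠ i → X ⊔ Subgroup.zpowers (g l) ≤ M i := fun l hl ↦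
      (hz l).2 ⟨hXM i, hgM l i hl⟩
    have h2 : ∀ l, X < X ⊔ Subgroup.zpowers (g l) := fun l ↦
      lt_of_le_of_ne le_sup_left fun h ↦ hgn l (hXM l (h ▸ hl l))
    have h3 : ∀ l m, m ≠ i → m ≠ l → l ≠ i → X ⊔ Subgroup.zpowers (g l) < M i :=
      fun l m hmi hml hli ↦ lt_of_le_of_ne (h1 l hli) fun h ↦
        hgn m ((hz l).2 ⟨hXM m, hgM l m hml.symm⟩ (h ▸ hgM m i hmi))
    refine hG.exists_le_stabilizer_pair (hM i) hX (h2 j) (h2 k) (h3 j k hik.symm hjk.symm hij.symm)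
      (h3 k j hij.symm hjk hik.symm)
      (le_antisymm (sup_le (h1 j hij.symm) (h1 k hik.symm)) (sup_le ?_ ?_))
    · exact le_sup_left.trans le_sup_left
    · rw [Subgroup.closure_le]
      rintro _ ⟨l, hli, rfl⟩
      obtain rfl | rfl := hcov l hli
      · exact Subgroup.mem_sup_left (hl _)
      · exact Subgroup.mem_sup_right (hl _)
  choose a b hab using hpair
  have hstab : ∀ i j, i ≠ j → g i ∈ stabilizer G ({a j, b j} : Set Ω) := fun i j hij ↦
    hab j (hgM i j hij)
  have hnstab : ∀ i, g i ∉ stabilizer G ({a i, b i} : Set Ω) := fun i hi ↦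
    hG.stabilizer_pair_ne_top _ _ (htop i _ (hab i) hi)
  obtain ⟨x, hx, hx1⟩ := X.bot_or_exists_ne_one.resolve_left hX
  have hxs : ∀ i, x ∈ stabilizer G ({a i, b i} : Set Ω) := fun i ↦ hab i (hXM i hx)
  obtain ⟨c, d, hcd⟩ := hG.exists_fixedBy_eq x hx1
  have hfixx : ∀ e, x • e = e → e = c ∨ e = d := fun e he ↦ by
    have : e ∈ fixedBy Ω x := he
    simpa [hcd] using this
  have hxfix : ∀ i, x • a i = a i ∧ x • b i = b i := by
    intro i
    by_contra hnot
    obtain ⟨hsa, hsb⟩ := (mem_stabilizer_pair.1 (hxs i)).resolve_left hnot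
    have hne : a i ≠ b i := fun h ↦ hnot ⟨by rw [hsa, h], by rw [hsb, h]⟩
    obtain ⟨j, k, hij, hik, hjk⟩ :=
      (by decide : ∀ i : Fin 3, ∃ j k : Fin 3, i ≠ j ∧ i ≠ k ∧ j ≠ k) i
    -- up to a factor `x`, the elements `g j` and `g k` fix both points of the pair
    have hy : ∀ l, l ≠ i → ∃ y ∈ X, (g l * y) • a i = a i ∧ (g l * y) • b i = b i := by
      intro l hl
      rcases mem_stabilizer_pair.1 (hstab l i hl) with h | h
      · exact ⟨1, X.one_mem, by simpa using h⟩
      · exact ⟨x, hx, by rw [mul_smul, mul_smul, hsa, hsb]; exact h.symm⟩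
    have hy1 : ∀ l, ∀ y ∈ X, g l * y ≠ 1 := fun l y hy h ↦
      hgn l (hXM l (by rw [eq_inv_of_mul_eq_one_left h]; exact X.inv_mem hy))
    have hsq : ∀ l m, l ≠ i → m ≠ i → l ≠ m → ∀ y ∈ X, (g l * y) • a i = a i →
        (g l * y) • b i = b i → (g l * y) * (g l * y) = 1 := by
      intro l m hl hm hlm y hyX hya hyb
      by_contra h1
      obtain ⟨e, f, hef⟩ := hG.exists_fixedBy_eq _ (hy1 l y hyX)
      have hfix : ∀ z, (g l * y) • z = z → z = a i ∨ z = b i := by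
        have hz : ∀ z, (g l * y) • z = z ↔ z = e ∨ z = f := fun z ↦ by
          rw [← mem_fixedBy, hef]; simp
        have h1 := (hz _).1 hya
        have h2 := (hz _).1 hyb
        intro z h
        have h3 := (hz _).1 h
        grind
      have hmem : g l * y ∈ M m := (M m).mul_mem (hgM l m hlm) (hXM m hyX)
      have hfm : (g l * y) • a m = a m ∧ (g l * y) • b m = b m := by
        refine (mem_stabilizer_pair.1 (hab m hmem)).elim id fun h ↦ ?_
        by_cases hne' : a m = b m
        · rw [hne'] at h ⊢
          exact h
        · exact absurd (hG.mul_self_of_swap _ _ _ hne' h.1 h.2) h1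
      have hset : ({a m, b m} : Set Ω) = {a i, b i} := by
        rw [Set.pair_eq_pair_iff]
        have h3 := hfix _ hfm.1
        have h4 := hfix _ hfm.2
        have h5 := mem_stabilizer_pair.1 (hxs m)
        grind
      exact hnstab m (hset ▸ hstab m i hm)
    obtain ⟨y, hyX, hya, hyb⟩ := hy j hij.symm
    obtain ⟨z, hzX, hza, hzb⟩ := hy k hik.symm
    have heq := hG.involution_unique _ _ _ _ hne (hy1 j y hyX) (hy1 k z hzX)
      (hsq j k hij.symm hik.symm hjk y hyX hya hyb)
      (hsq k j hik.symm hij.symm hjk.symm z hzX hza hzb) hya hyb hza hzb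
    refine hgn j ?_
    rw [eq_mul_inv_of_mul_eq heq]
    exact (M j).mul_mem ((M j).mul_mem (hgM k j hjk.symm) (hXM j hzX))
      ((M j).inv_mem (hXM j hyX))
  have htype : ∀ i, ({a i, b i} : Set Ω) = {c, c} ∨ ({a i, b i} : Set Ω) = {d, d} ∨
      ({a i, b i} : Set Ω) = {c, d} := fun i ↦ by
    simp only [Set.pair_eq_pair_iff]
    have h1 := hfixx _ (hxfix i).1
    have h2 := hfixx _ (hxfix i).2
    grind
  have hcd' : ∀ y, y ∈ stabilizer G ({c, c} : Set Ω) → y ∈ stabilizer G ({d, d} : Set Ω) →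
      y ∈ stabilizer G ({c, d} : Set Ω) := fun y h1 h2 ↦ by
    rw [mem_stabilizer_pair] at *
    grind
  have hc' : ∀ y, y ∈ stabilizer G ({c, c} : Set Ω) → y ∈ stabilizer G ({c, d} : Set Ω) →
      y ∈ stabilizer G ({d, d} : Set Ω) := fun y h1 h2 ↦ by
    rw [mem_stabilizer_pair] at *
    grind
  have hd' : ∀ y, y ∈ stabilizer G ({d, d} : Set Ω) → y ∈ stabilizer G ({c, d} : Set Ω) →
      y ∈ stabilizer G ({c, c} : Set Ω) := fun y h1 h2 ↦ by
    rw [mem_stabilizer_pair] at *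
    grind
  have n0 := hnstab 0
  have s1 := hstab 0 1 (by decide)
  have s2 := hstab 0 2 (by decide)
  have t0 := hstab 1 0 (by decide)
  have t2 := hstab 1 2 (by decide)
  have n1 := hnstab 1
  rcases htype 0 with h0 | h0 | h0 <;> rcases htype 1 with h1 | h1 | h1 <;>
    rcases htype 2 with h2 | h2 | h2 <;> rw [h0] at n0 t0 <;> rw [h1] at s1 n1 <;>
    rw [h2] at s2 t2 <;> grind

end IsMoebiusAction

section ProjectiveLine

open scoped LinearAlgebra.Projectivization MatrixGroups

variable {F : Type*} [Field F]

/-- `PSL(2, F)` acts on the projective line over the algebraic closure of `F`. -/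
noncomputable instance Matrix.ProjectiveSpecialLinearGroup.mulActionAlgebraicClosure :
    MulAction PSL(2, F) (ℙ (AlgebraicClosure F) (Fin 2 → AlgebraicClosure F)) :=
  compHom _ (QuotientGroup.map (Subgroup.center SL(2, F))
    (Subgroup.center SL(2, AlgebraicClosure F))
    (Matrix.SpecialLinearGroup.map (algebraMap F (AlgebraicClosure F))) (by
      intro A hA
      rw [Subgroup.mem_comap]
      rw [Matrix.SpecialLinearGroup.mem_center_iff] at hA ⊢
      obtain ⟨r, hr, h⟩ := hA
      refine ⟨algebraMap _ _ r, by rw [← map_pow, hr, map_one], ?_⟩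
      ext i j
      simp only [Matrix.SpecialLinearGroup.map_apply_coe, ← h]
      fin_cases i <;> fin_cases j <;> simp))

theorem Projectivization.mk_eq_mk_iff_fin_two {K : Type*} [Field K] {v w : Fin 2 → K}
    (hv : v ≠ 0) (hw : w ≠ 0) :
    Projectivization.mk K v hv = Projectivization.mk K w hw ↔ v 0 * w 1 = v 1 * w 0 := by
  rw [Projectivization.mk_eq_mk_iff']
  constructor
  · rintro ⟨a, rfl⟩
    simp only [Pi.smul_apply, smul_eq_mul]
    ring
  · intro h
    by_cases h0 : w 0 = 0
    · have h1 : w 1 ≠ 0 := fun h1 ↦ hw (by ext i; fin_cases i <;> simp [h0, h1])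
      refine ⟨v 1 / w 1, ?_⟩
      ext i
      fin_cases i
      · simp only [h0, mul_zero, mul_eq_zero, h1, or_false] at h
        simp [h, h0]
      · simp [h1]
    · refine ⟨v 0 / w 0, ?_⟩
      ext i
      fin_cases i
      · simp [h0]
      · simp only [Fin.mk_one, Pi.smul_apply, smul_eq_mul]
        field_simp
        linear_combination h

theorem Matrix.SpecialLinearGroup.mem_center_fin_two {A : SL(2, F)} :
    A ∈ Subgroup.center SL(2, F) ↔ A 0 1 = 0 ∧ A 1 0 = 0 ∧ A 0 0 = A 1 1 := by
  rw [Matrix.SpecialLinearGroup.mem_center_iff]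
  constructor
  · rintro ⟨r, -, h⟩
    simp [← h]
  · rintro ⟨h1, h2, h3⟩
    have := A.det_coe
    rw [Matrix.det_fin_two] at this
    refine ⟨A 0 0, ?_, ?_⟩
    · simp only [Fintype.card_fin]
      linear_combination this + A 0 1 * h2 + A 0 0 * h3
    · ext i j
      fin_cases i <;> fin_cases j <;> simp [h1, h2, h3]

namespace Matrix.ProjectiveSpecialLinearGroup

theorem coe_eq_one_iff {A : SL(2, F)} :
    (A : PSL(2, F)) = 1 ↔ A 0 1 = 0 ∧ A 1 0 = 0 ∧ A 0 0 = A 1 1 := by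
  rw [QuotientGroup.eq_one_iff, Matrix.SpecialLinearGroup.mem_center_fin_two]

local notation "ℱ" => AlgebraicClosure F
local notation "φ" => algebraMap F (AlgebraicClosure F)

theorem coe_smul_mk_eq_mk_iff (A : SL(2, F)) {v w : Fin 2 → ℱ} (hv : v ≠ 0) (hw : w ≠ 0) :
    (A : PSL(2, F)) • Projectivization.mk ℱ v hv = Projectivization.mk ℱ w hw ↔
      (φ (A 0 0) * v 0 + φ (A 0 1) * v 1) * w 1 = (φ (A 1 0) * v 0 + φ (A 1 1) * v 1) * w 0 := by
  have h : (A : PSL(2, F)) • Projectivization.mk ℱ v hv =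
      (Matrix.SpecialLinearGroup.map (algebraMap F (AlgebraicClosure F)) A) •
        Projectivization.mk ℱ v hv := rfl
  rw [h, Projectivization.smul_mk, Projectivization.mk_eq_mk_iff_fin_two]
  have h' : ∀ i, ((Matrix.SpecialLinearGroup.map (algebraMap F (AlgebraicClosure F)) A) • v) i =
      φ (A i 0) * v 0 + φ (A i 1) * v 1 := fun i ↦ by
    rw [Matrix.SpecialLinearGroup.smul_def]
    simp [Matrix.smul_eq_mulVec, Matrix.mulVec, dotProduct, Fin.sum_univ_two]
  rw [h', h']

theorem exists_factor_of_isAlgClosed {K : Type*} [Field K] [IsAlgClosed K] (h2 : (2 : K) ≠ 0)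
    (a b c d : K) (hne : ¬ (b = 0 ∧ c = 0 ∧ a = d)) :
    ∃ v w : Fin 2 → K, v ≠ 0 ∧ w ≠ 0 ∧ ∃ k ≠ 0,
      (∀ z : Fin 2 → K, (z 0 * v 1 - z 1 * v 0) * (z 0 * w 1 - z 1 * w 0) =
        k * ((a * z 0 + b * z 1) * z 1 - (c * z 0 + d * z 1) * z 0)) ∧
      (v 0 * w 1 - v 1 * w 0) ^ 2 = k ^ 2 * ((a - d) ^ 2 + 4 * b * c) := by
  by_cases hc : c = 0
  · refine ⟨![1, 0], ![-b, a - d], fun h ↦ ?_, fun h ↦ ?_, -1, by simp, fun z ↦ ?_, ?_⟩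
    · simpa using congrFun h 0
    · have h0 := congrFun h 0
      have h1 := congrFun h 1
      simp at h0 h1
      exact hne ⟨h0, hc, sub_eq_zero.1 h1⟩
    · simp [hc]
      ring
    · simp [hc]
  · obtain ⟨s, hs⟩ := IsAlgClosed.exists_eq_mul_self ((a - d) ^ 2 + 4 * b * c)
    refine ⟨![a - d + s, 2 * c], ![a - d - s, 2 * c], fun h ↦ ?_, fun h ↦ ?_, -4 * c, ?_,
      fun z ↦ ?_, ?_⟩
    · simpa [h2, hc] using congrFun h 1
    · simpa [h2, hc] using congrFun h 1
    · have : (-4 * c : K) = -(2 * 2 * c) := by ring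
      rw [this]
      simp [h2, hc]
    · simp only [Matrix.cons_val_zero, Matrix.cons_val_one]
      linear_combination z 1 ^ 2 * hs
    · simp only [Matrix.cons_val_zero, Matrix.cons_val_one]
      linear_combination (-16 * c ^ 2) * hs

theorem exists_fixedBy_eq (h2 : (2 : F) ≠ 0) (A : SL(2, F)) (hA : (A : PSL(2, F)) ≠ 1) :
    ∃ a b : ℙ ℱ (Fin 2 → ℱ), fixedBy _ (A : PSL(2, F)) = {a, b} ∧
      (a = b → (A 0 0 + A 1 1) ^ 2 = 4) := by
  rw [Ne, coe_eq_one_iff] at hA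
  have hdet := A.det_coe
  rw [Matrix.det_fin_two] at hdet
  obtain ⟨v, w, hv, hw, k, hk, hz, hdisc⟩ := exists_factor_of_isAlgClosed
    (K := ℱ) (by simpa only [map_ofNat] using (map_ne_zero φ).2 h2) (φ (A 0 0)) (φ (A 0 1)) (φ (A 1 0))
    (φ (A 1 1)) (by simpa using hA)
  refine ⟨.mk ℱ v hv, .mk ℱ w hw, ?_, fun h ↦ ?_⟩
  · ext z
    induction z using Projectivization.ind with | h z hz0 => ?_
    rw [mem_fixedBy, coe_smul_mk_eq_mk_iff, Set.mem_insert_iff, Set.mem_singleton_iff,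
      Projectivization.mk_eq_mk_iff_fin_two, Projectivization.mk_eq_mk_iff_fin_two,
      ← sub_eq_zero, ← mul_right_inj' hk, ← hz, mul_zero, mul_eq_zero, sub_eq_zero, sub_eq_zero]
  · rw [Projectivization.mk_eq_mk_iff_fin_two, ← sub_eq_zero] at h
    rw [h, zero_pow two_ne_zero, zero_eq_mul, or_iff_right (pow_ne_zero 2 hk)] at hdisc
    apply (φ).injective
    have hdet' := congrArg φ hdet
    simp only [map_sub, map_mul, map_one, map_pow, map_add, map_ofNat] at hdet' ⊢
    linear_combination hdisc + 4 * hdet'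

theorem coe_mul_self_eq_one_iff {A : SL(2, F)} :
    (A : PSL(2, F)) * A = 1 ↔ (A : PSL(2, F)) = 1 ∨ A 0 0 + A 1 1 = 0 := by
  rw [← QuotientGroup.mk_mul, coe_eq_one_iff, coe_eq_one_iff]
  simp only [Matrix.SpecialLinearGroup.coe_mul, Matrix.mul_apply, Fin.sum_univ_two]
  constructor
  · rintro ⟨h1, h2, h3⟩
    by_cases ht : A 0 0 + A 1 1 = 0
    · exact .inr ht
    · refine .inl ⟨?_, ?_, ?_⟩ <;> apply mul_left_cancel₀ ht
      · linear_combination h1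
      · linear_combination h2
      · linear_combination h3
  · rintro (⟨h1, h2, h3⟩ | h)
    · simp [h1, h2, h3]
    · refine ⟨?_, ?_, ?_⟩
      · linear_combination A 0 1 * h
      · linear_combination A 1 0 * h
      · linear_combination (A 0 0 - A 1 1) * h

theorem mul_self_of_swap (g : PSL(2, F)) (x y : ℙ ℱ (Fin 2 → ℱ)) (hxy : x ≠ y)
    (hx : g • x = y) (hy : g • y = x) : g * g = 1 := by
  obtain ⟨A, rfl⟩ := QuotientGroup.mk_surjective g
  induction x using Projectivization.ind with | h v hv => ?_
  induction y using Projectivization.ind with | h w hw => ?_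
  rw [coe_smul_mk_eq_mk_iff] at hx hy
  rw [Ne, Projectivization.mk_eq_mk_iff_fin_two, ← sub_eq_zero] at hxy
  refine coe_mul_self_eq_one_iff.2 (.inr ((φ).injective ?_))
  rw [map_add, map_zero]
  apply mul_left_cancel₀ hxy
  linear_combination hx - hy

theorem factor_of_eval_eq_zero {K : Type*} [Field K] {a b c d : K} {v w : Fin 2 → K}
    (hv : (a * v 0 + b * v 1) * v 1 = (c * v 0 + d * v 1) * v 0)
    (hw : (a * w 0 + b * w 1) * w 1 = (c * w 0 + d * w 1) * w 0) :
    ∃ k, (v 0 * w 1 - v 1 * w 0) ^ 2 * b = k * (v 0 * w 0) ∧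
      (v 0 * w 1 - v 1 * w 0) ^ 2 * c = -k * (v 1 * w 1) ∧
      (v 0 * w 1 - v 1 * w 0) ^ 2 * (a - d) = -k * (v 0 * w 1 + v 1 * w 0) := by
  refine ⟨-(2 * b * v 1 * w 1 + (a - d) * (v 0 * w 1 + v 1 * w 0) - 2 * c * v 0 * w 0),
    ?_, ?_, ?_⟩
  · linear_combination w 0 ^ 2 * hv + v 0 ^ 2 * hw
  · linear_combination (-w 1 ^ 2) * hv - v 1 ^ 2 * hw
  · linear_combination (-2 * w 0 * w 1) * hv - 2 * v 0 * v 1 * hw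

theorem involution_unique (h2 : (2 : F) ≠ 0) (g h : PSL(2, F)) (x y : ℙ ℱ (Fin 2 → ℱ)) (hxy : x ≠ y)
    (hg1 : g ≠ 1) (hh1 : h ≠ 1) (hg : g * g = 1) (hh : h * h = 1) (hgx : g • x = x)
    (hgy : g • y = y) (hhx : h • x = x) (hhy : h • y = y) : g = h := by
  obtain ⟨A, rfl⟩ := QuotientGroup.mk_surjective g
  obtain ⟨B, rfl⟩ := QuotientGroup.mk_surjective h
  induction x using Projectivization.ind with | h v hv => ?_
  induction y using Projectivization.ind with | h w hw => ?_
  rw [coe_smul_mk_eq_mk_iff] at hgx hgy hhx hhy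
  rw [Ne, Projectivization.mk_eq_mk_iff_fin_two, ← sub_eq_zero] at hxy
  have hA := congrArg φ ((coe_mul_self_eq_one_iff.1 hg).resolve_left hg1)
  have hB := congrArg φ ((coe_mul_self_eq_one_iff.1 hh).resolve_left hh1)
  rw [map_add, map_zero] at hA hB
  obtain ⟨k, hk1, hk2, hk3⟩ := factor_of_eval_eq_zero hgx hgy
  obtain ⟨l, hl1, hl2, hl3⟩ := factor_of_eval_eq_zero hhx hhy
  rw [eq_inv_of_mul_eq_one_right hh, ← mul_eq_one_iff_eq_inv, ← QuotientGroup.mk_mul,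
    coe_eq_one_iff]
  simp only [Matrix.SpecialLinearGroup.coe_mul, Matrix.mul_apply, Fin.sum_univ_two]
  have hD := mul_ne_zero (pow_ne_zero 4 hxy) ((map_ne_zero φ).2 h2)
  rw [map_ofNat] at hD
  generalize v 0 * w 1 - v 1 * w 0 = D at *
  refine ⟨?_, ?_, ?_⟩ <;> apply (φ).injective <;> apply mul_left_cancel₀ hD <;>
    simp only [map_add, map_mul, map_zero]
  · linear_combination D ^ 4 * φ (B 0 1) * hA + D ^ 4 * φ (A 0 1) * hB +
      D ^ 2 * φ (B 0 1) * hk3 - k * (v 0 * w 1 + v 1 * w 0) * hl1 -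
      D ^ 2 * (φ (B 0 0) - φ (B 1 1)) * hk1 - k * (v 0 * w 0) * hl3
  · linear_combination D ^ 4 * φ (B 1 0) * hA + D ^ 4 * φ (A 1 0) * hB +
      D ^ 2 * (φ (B 0 0) - φ (B 1 1)) * hk2 - k * (v 1 * w 1) * hl3 -
      D ^ 2 * φ (B 1 0) * hk3 + k * (v 0 * w 1 + v 1 * w 0) * hl2
  · linear_combination D ^ 4 * (φ (B 0 0) - φ (B 1 1)) * hA +
      D ^ 4 * (φ (A 0 0) - φ (A 1 1)) * hB + 2 * D ^ 2 * φ (B 1 0) * hk1 +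
      2 * k * (v 0 * w 0) * hl2 - 2 * D ^ 2 * φ (B 0 1) * hk2 + 2 * k * (v 1 * w 1) * hl1

theorem linear_mul_self (A : SL(2, F)) (x y : F) :
    (x • (A : Matrix (Fin 2) (Fin 2) F) + y • 1) * A =
      (x * (A 0 0 + A 1 1) + y) • (A : Matrix (Fin 2) (Fin 2) F) + (-x) • 1 := by
  have hdet := A.det_coe
  rw [Matrix.det_fin_two] at hdet
  ext i j
  fin_cases i <;> fin_cases j <;>
    simp only [Matrix.mul_apply, Fin.sum_univ_two, Matrix.add_apply, Matrix.smul_apply, smul_eq_mul,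
      Matrix.one_apply, Fin.zero_eta, Fin.mk_one, if_true, zero_ne_one, one_ne_zero, if_false]
  · linear_combination -x * hdet
  · ring
  · ring
  · linear_combination -x * hdet

theorem eq_zero_of_linear {A B : SL(2, F)} (hA : (A : PSL(2, F)) ≠ 1) {x y : F}
    (hB : (B : Matrix (Fin 2) (Fin 2) F) = x • (A : Matrix (Fin 2) (Fin 2) F) + y • 1)
    (hB1 : (B : PSL(2, F)) = 1) : x = 0 := by
  rw [Ne, coe_eq_one_iff] at hA
  rw [coe_eq_one_iff, hB] at hB1
  by_contra hx
  simp [hx] at hB1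
  exact hA hB1

theorem coe_linear_pow (A : SL(2, F)) :
    ((A ^ 4 : SL(2, F)) : Matrix (Fin 2) (Fin 2) F) =
      ((A 0 0 + A 1 1) ^ 3 - 2 * (A 0 0 + A 1 1)) • (A : Matrix (Fin 2) (Fin 2) F) +
        (1 - (A 0 0 + A 1 1) ^ 2) • 1 ∧
    ((A ^ 5 : SL(2, F)) : Matrix (Fin 2) (Fin 2) F) =
      ((A 0 0 + A 1 1) ^ 4 - 3 * (A 0 0 + A 1 1) ^ 2 + 1) • (A : Matrix (Fin 2) (Fin 2) F) +
        (2 * (A 0 0 + A 1 1) - (A 0 0 + A 1 1) ^ 3) • 1 := by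
  have h0 : (A : Matrix (Fin 2) (Fin 2) F) =
      (1 : F) • (A : Matrix (Fin 2) (Fin 2) F) + (0 : F) • 1 := by simp
  have h4 : ((A ^ 4 : SL(2, F)) : Matrix (Fin 2) (Fin 2) F) =
      ((A 0 0 + A 1 1) ^ 3 - 2 * (A 0 0 + A 1 1)) • (A : Matrix (Fin 2) (Fin 2) F) +
        (1 - (A 0 0 + A 1 1) ^ 2) • 1 := by
    rw [Matrix.SpecialLinearGroup.coe_pow, pow_succ, pow_succ, pow_succ, pow_one]
    nth_rw 1 [h0]
    rw [linear_mul_self, linear_mul_self, linear_mul_self]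
    congr 2 <;> ring
  refine ⟨h4, ?_⟩
  rw [pow_succ, Matrix.SpecialLinearGroup.coe_mul, h4, linear_mul_self]
  congr 2 <;> ring

theorem orderOf_ne_four (hF : ¬ IsSquare (2 : F)) (g : PSL(2, F)) : orderOf g ≠ 4 := by
  obtain ⟨A, rfl⟩ := QuotientGroup.mk_surjective g
  intro h
  have h4 : ((A ^ 4 : SL(2, F)) : PSL(2, F)) = 1 := by
    rw [QuotientGroup.mk_pow]
    exact h ▸ pow_orderOf_eq_one _
  have h2 : (A : PSL(2, F)) * A ≠ 1 := fun h2 ↦ by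
    rw [← pow_two] at h2
    have := orderOf_dvd_of_pow_eq_one h2
    rw [h] at this
    omega
  rw [Ne, coe_mul_self_eq_one_iff, not_or] at h2
  have h0 := eq_zero_of_linear h2.1 (coe_linear_pow A).1 h4
  refine hF ⟨A 0 0 + A 1 1, mul_left_cancel₀ h2.2 ?_⟩
  linear_combination -h0

theorem orderOf_ne_five (hF : ¬ IsSquare (5 : F)) (g : PSL(2, F)) : orderOf g ≠ 5 := by
  obtain ⟨A, rfl⟩ := QuotientGroup.mk_surjective g
  intro h
  have h5 : ((A ^ 5 : SL(2, F)) : PSL(2, F)) = 1 := by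
    rw [QuotientGroup.mk_pow]
    exact h ▸ pow_orderOf_eq_one _
  have h1 : (A : PSL(2, F)) ≠ 1 := fun h1 ↦ by
    rw [h1, orderOf_one] at h
    omega
  have h0 := eq_zero_of_linear h1 (coe_linear_pow A).2 h5
  refine hF ⟨2 * (A 0 0 + A 1 1) ^ 2 - 3, ?_⟩
  linear_combination -4 * h0

theorem stabilizer_pair_ne_top (h2 : (2 : F) ≠ 0) (x y : ℙ ℱ (Fin 2 → ℱ)) :
    stabilizer PSL(2, F) ({x, y} : Set (ℙ ℱ (Fin 2 → ℱ))) ≠ ⊤ := by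
  intro htop
  have hfix : ∀ A : SL(2, F), A 0 0 = 1 → A 1 1 = 1 → (A : PSL(2, F)) ≠ 1 →
      (A : PSL(2, F)) • x = x := by
    intro A h0 h1 hA
    have hmem : (A : PSL(2, F)) ∈ stabilizer PSL(2, F) ({x, y} : Set (ℙ ℱ (Fin 2 → ℱ))) :=
      htop ▸ Subgroup.mem_top _
    rw [mem_stabilizer_pair] at hmem
    rcases hmem with h | h
    · exact h.1
    · by_cases hxy : x = y
      · exact h.1.trans hxy.symm
      · have := (coe_mul_self_eq_one_iff.1 (mul_self_of_swap _ _ _ hxy h.1 h.2)).resolve_left hA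
        rw [h0, h1, one_add_one_eq_two] at this
        exact absurd this h2
  have hT := hfix (.transvection zero_ne_one 1)
  have hT' := hfix (.transvection one_ne_zero 1)
  induction x using Projectivization.ind with | h v hv => ?_
  rw [Ne, coe_eq_one_iff, coe_smul_mk_eq_mk_iff] at hT hT'
  simp [Matrix.SpecialLinearGroup.transvection_coe] at hT hT'
  have h1 : v 1 = 0 := by
    rw [← mul_self_eq_zero]
    linear_combination hT
  have h0 : v 0 = 0 := by
    rw [← mul_self_eq_zero]
    linear_combination -hT'
  exact hv (by ext i; fin_cases i <;> simp [h0, h1])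

/-- A fixed vector of an element of trace two. -/
theorem exists_smul_eq_of_trace (h2 : (2 : F) ≠ 0) (A : SL(2, F)) (h : A 0 0 + A 1 1 = 2) :
    ∃ v : Fin 2 → F, v ≠ 0 ∧ A • v = v := by
  have hdet := A.det_coe
  rw [Matrix.det_fin_two] at hdet
  by_cases hc : A 1 0 = 0
  · refine ⟨![1, 0], fun h ↦ by simpa using congrFun h 0, ?_⟩
    have ha : A 0 0 = 1 := by
      rw [← sub_eq_zero, ← sq_eq_zero_iff]
      linear_combination A 0 0 * h - hdet - A 0 1 * hc
    ext i
    fin_cases i <;> simp [Matrix.SpecialLinearGroup.smul_def, Matrix.smul_eq_mulVec, ha, hc]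
  · refine ⟨![A 0 0 - A 1 1, 2 * A 1 0], fun h ↦ ?_, ?_⟩
    · simpa [h2, hc] using congrFun h 1
    · ext i
      fin_cases i <;> simp [Matrix.SpecialLinearGroup.smul_def, Matrix.smul_eq_mulVec]
      · linear_combination (A 0 0 + 1) * h - 2 * hdet
      · linear_combination A 1 0 * h

theorem coe_smul_mk_map (A : SL(2, F)) {v : Fin 2 → F} (hv : φ ∘ v ≠ 0) :
    (A : PSL(2, F)) • Projectivization.mk ℱ (φ ∘ v) hv = Projectivization.mk ℱ (φ ∘ v) hv ↔
      v 0 * (A • v) 1 = v 1 * (A • v) 0 := by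
  rw [coe_smul_mk_eq_mk_iff, ← (φ).injective.eq_iff]
  simp [Matrix.SpecialLinearGroup.smul_def, Matrix.smul_eq_mulVec, Matrix.mulVec, dotProduct]
  grind

theorem eq_transvection_of_smul_eq {A : SL(2, F)} {i j : Fin 2} (hij : i ≠ j)
    (h : A • (Pi.single i 1 : Fin 2 → F) = Pi.single i 1) :
    A = .transvection hij (A i j) := by
  have hdet := A.det_coe
  rw [Matrix.det_fin_two] at hdet
  have h0 := congrFun h 0
  have h1 := congrFun h 1
  rw [Matrix.SpecialLinearGroup.smul_def, Matrix.smul_eq_mulVec, Matrix.mulVec_single_one,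
    Matrix.col_apply] at h0 h1
  ext k l
  fin_cases i <;> fin_cases j <;> fin_cases k <;> fin_cases l <;>
    first
    | exact absurd rfl hij
    | simp_all [Matrix.SpecialLinearGroup.transvection_coe]

theorem transvection_mul_transvection {i j : Fin 2} (hij : i ≠ j) (a b : F) :
    Matrix.SpecialLinearGroup.transvection hij a * .transvection hij b =
      .transvection hij (a + b) := by
  refine Subtype.ext ?_
  simp [Matrix.SpecialLinearGroup.transvection_coe, mul_add, add_mul, Matrix.single_add,
    Matrix.single_mul_single_of_ne _ _ _ _ hij.symm, add_assoc]

theorem eq_top_of_exists_transvection {p : ℕ} [Fact p.Prime] {H : Subgroup SL(2, ZMod p)}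
    (h : ∀ (i j : Fin 2) (hij : i ≠ j), ∃ c ≠ 0, .transvection hij c ∈ H) : H = ⊤ := by
  refine eq_top_iff.2 fun M _ ↦ SL2.transvection_induction _ (fun i j hij a ↦ ?_)
    (fun _ _ ↦ mul_mem) M
  obtain ⟨c, hc, hH⟩ := h i j hij
  have hpow : ∀ n : ℕ, Matrix.SpecialLinearGroup.transvection hij ((n : ZMod p) * c) =
      (.transvection hij c) ^ n := by
    intro n
    induction n with
    | zero => simp
    | succ n ih =>
      rw [pow_succ, ← ih, transvection_mul_transvection, Nat.cast_succ, add_mul, one_mul]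
  have := H.pow_mem hH (a / c).val
  rwa [← hpow, ZMod.natCast_zmod_val, div_mul_cancel₀ a hc] at this

theorem exists_smul_single {v w : Fin 2 → F} (h : v 0 * w 1 - v 1 * w 0 ≠ 0) :
    ∃ (S : SL(2, F)) (d : F), S • (Pi.single 0 1 : Fin 2 → F) = v ∧
      S • (Pi.single 1 1 : Fin 2 → F) = d • w := by
  have hdet : (!![v 0, (v 0 * w 1 - v 1 * w 0)⁻¹ * w 0;
      v 1, (v 0 * w 1 - v 1 * w 0)⁻¹ * w 1]).det = 1 := by
    rw [Matrix.det_fin_two_of]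
    linear_combination mul_inv_cancel₀ h
  let S : SL(2, F) := ⟨_, hdet⟩
  refine ⟨S, (v 0 * w 1 - v 1 * w 0)⁻¹, ?_, ?_⟩ <;>
    rw [Matrix.SpecialLinearGroup.smul_def, Matrix.smul_eq_mulVec, Matrix.mulVec_single_one] <;>
    ext i <;> fin_cases i <;> simp [S]

theorem exists_transvection_mem {H : Subgroup SL(2, F)} {A S : SL(2, F)} {v : Fin 2 → F}
    (hA : A ∈ H) (hA1 : A ≠ 1) (hv : A • v = v) {i j : Fin 2} (hij : i ≠ j) {d : F}
    (hS : S • (Pi.single i 1 : Fin 2 → F) = d • v) :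
    ∃ c ≠ 0, .transvection hij c ∈ H.comap (MulAut.conj S).toMonoidHom := by
  have h := eq_transvection_of_smul_eq (A := S⁻¹ * A * S) hij (by
    rw [mul_smul, mul_smul, hS, smul_comm A d v, hv, ← hS, inv_smul_smul])
  refine ⟨(S⁻¹ * A * S) i j, fun hc ↦ hA1 ?_, ?_⟩
  · rw [hc, Matrix.SpecialLinearGroup.transvection_coeff_zero] at h
    rw [mul_assoc, inv_mul_eq_one, eq_comm, mul_eq_right] at h
    exact h
  · rw [← h, Subgroup.mem_comap]
    simpa [mul_assoc] using hA

theorem eq_top_of_smul_eq {p : ℕ} [Fact p.Prime] {H : Subgroup SL(2, ZMod p)}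
    {A B : SL(2, ZMod p)} {v : Fin 2 → ZMod p} (hA : A ∈ H) (hA1 : A ≠ 1) (hv : A • v = v)
    (hB : B ∈ H) (h : v 0 * (B • v) 1 ≠ v 1 * (B • v) 0) : H = ⊤ := by
  obtain ⟨S, d, hS0, hS1⟩ := exists_smul_single (sub_ne_zero.2 h)
  have htop : H.comap (MulAut.conj S).toMonoidHom = ⊤ := by
    refine eq_top_of_exists_transvection fun i j hij ↦ ?_
    rcases eq_or_ne i 0 with rfl | hi
    · exact exists_transvection_mem hA hA1 hv hij (d := 1) (by rwa [one_smul])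
    · obtain rfl : i = 1 := by omega
      refine exists_transvection_mem (H.mul_mem (H.mul_mem hB hA) (H.inv_mem hB)) ?_ ?_ hij hS1
      · rwa [Ne, mul_inv_eq_one, mul_eq_left]
      · rw [mul_smul, mul_smul, inv_smul_smul, hv]
  refine eq_top_iff.2 fun M _ ↦ ?_
  have : S⁻¹ * M * S ∈ H.comap (MulAut.conj S).toMonoidHom := htop ▸ Subgroup.mem_top _
  simpa [mul_assoc] using this

theorem exists_fixedBy_eq_of_ne_top {p : ℕ} [Fact p.Prime] (h2 : (2 : ZMod p) ≠ 0)
    {H : Subgroup PSL(2, ZMod p)} (hH : H ≠ ⊤)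
    (hfix : ∀ x : ℙ (AlgebraicClosure (ZMod p)) (Fin 2 → AlgebraicClosure (ZMod p)),
      ¬ H ≤ stabilizer PSL(2, ZMod p) ({x, x} : Set (ℙ _ _)))
    {h : PSL(2, ZMod p)} (hh : h ∈ H) (h1 : h ≠ 1) :
    ∃ x y : ℙ (AlgebraicClosure (ZMod p)) (Fin 2 → AlgebraicClosure (ZMod p)),
      x ≠ y ∧ fixedBy _ h = {x, y} := by
  obtain ⟨A, rfl⟩ := QuotientGroup.mk_surjective h
  obtain ⟨x, y, hxy, ht⟩ := exists_fixedBy_eq h2 A h1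
  refine ⟨x, y, fun heq ↦ hH ?_, hxy⟩
  have key : ∀ B : SL(2, ZMod p), (B : PSL(2, ZMod p)) ∈ H → (B : PSL(2, ZMod p)) ≠ 1 →
      B 0 0 + B 1 1 = 2 → H = ⊤ := by
    intro B hB hB1 htr
    obtain ⟨v, hv0, hv⟩ := exists_smul_eq_of_trace h2 B htr
    have hv0' : algebraMap (ZMod p) (AlgebraicClosure (ZMod p)) ∘ v ≠ 0 := fun h ↦ hv0 <| by
      ext i
      simpa using congrFun h i
    obtain ⟨c, hcH, hc⟩ := SetLike.not_le_iff_exists.1 (hfix (.mk _ _ hv0'))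
    obtain ⟨C, rfl⟩ := QuotientGroup.mk_surjective c
    rw [mem_stabilizer_pair, or_self, and_self, coe_smul_mk_map] at hc
    have := eq_top_of_smul_eq (H := H.comap (QuotientGroup.mk' _)) (A := B) (B := C) hB
      (by rintro rfl; exact hB1 rfl) hv hcH hc
    rw [← Subgroup.map_comap_eq_self_of_surjective (QuotientGroup.mk'_surjective _) H, this,
      ← MonoidHom.range_eq_map, MonoidHom.range_eq_top.2 (QuotientGroup.mk'_surjective _)]
  have ht' : (A 0 0 + A 1 1 - 2) * (A 0 0 + A 1 1 + 2) = 0 := by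
    linear_combination ht heq
  rcases mul_eq_zero.1 ht' with h | h
  · exact key A hh h1 (sub_eq_zero.1 h)
  · have hneg : ((-A : SL(2, ZMod p)) : PSL(2, ZMod p)) = A := by
      rw [QuotientGroup.eq, Matrix.SpecialLinearGroup.mem_center_fin_two]
      simp
    refine key (-A) (hneg ▸ hh) (hneg ▸ h1) ?_
    simp only [Matrix.SpecialLinearGroup.coe_neg, Matrix.neg_apply]
    linear_combination -h

theorem isMoebiusAction {p : ℕ} [Fact p.Prime] (hF2 : ¬ IsSquare (2 : ZMod p))
    (hF5 : ¬ IsSquare (5 : ZMod p)) :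
    IsMoebiusAction PSL(2, ZMod p)
      (ℙ (AlgebraicClosure (ZMod p)) (Fin 2 → AlgebraicClosure (ZMod p))) := by
  have h2 : (2 : ZMod p) ≠ 0 := by
    rintro h
    exact hF2 (h ▸ IsSquare.zero)
  exact
  { exists_fixedBy_eq := fun g hg ↦ by
      obtain ⟨A, rfl⟩ := QuotientGroup.mk_surjective g
      obtain ⟨a, b, h, -⟩ := exists_fixedBy_eq h2 A hg
      exact ⟨a, b, h⟩
    mul_self_of_swap := mul_self_of_swap
    involution_unique := involution_unique h2
    stabilizer_pair_ne_top := stabilizer_pair_ne_top h2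
    exists_fixedBy_eq_of_ne_top := fun _ hH hfix _ ↦ exists_fixedBy_eq_of_ne_top h2 hH hfix
    orderOf_ne_four := orderOf_ne_four hF2
    orderOf_ne_five := orderOf_ne_five hF5 }

end Matrix.ProjectiveSpecialLinearGroup
end ProjectiveLine

section Generation

variable {G : Type*} [Group G]

theorem IsIrred.injective {n : ℕ} {g : Fin n → G} (hg : IsGenSeq g) (hi : IsIrred g) :
    Function.Injective g := by
  intro i j hij
  by_contra hne
  refine hi i (eq_top_iff.2 (hg.symm.le.trans (Subgroup.closure_mono ?_)))
  rintro _ ⟨k, rfl⟩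
  by_cases hk : k = i
  · exact ⟨j, Ne.symm hne, by rw [hk, hij]⟩
  · exact ⟨k, hk, rfl⟩

theorem IsMoebiusAction.three_le_of_isGenSeq {Ω : Type*} [MulAction G Ω] [Nontrivial G]
    (hG : IsMoebiusAction G Ω) {n : ℕ} {g : Fin n → G} (hg : IsGenSeq g)
    (hinv : ∀ i, g i * g i = 1) : 3 ≤ n := by
  by_contra! hn
  obtain ⟨a, b, ha, hb, hab⟩ : ∃ a b : G, a * a = 1 ∧ b * b = 1 ∧ Subgroup.closure {a, b} = ⊤ := by
    interval_cases n
    · refine ⟨1, 1, by simp, by simp, eq_top_iff.2 (hg.symm.le.trans (Subgroup.closure_mono ?_))⟩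
      rintro _ ⟨i, rfl⟩
      exact i.elim0
    · refine ⟨g 0, g 0, hinv 0, hinv 0,
        eq_top_iff.2 (hg.symm.le.trans (Subgroup.closure_mono ?_))⟩
      rintro _ ⟨i, rfl⟩
      fin_cases i
      simp
    · refine ⟨g 0, g 1, hinv 0, hinv 1,
        eq_top_iff.2 (hg.symm.le.trans (Subgroup.closure_mono ?_))⟩
      rintro _ ⟨i, rfl⟩
      fin_cases i <;> simp
  obtain ⟨x, hx, hax, hbx⟩ : ∃ x : G, x ≠ 1 ∧ a * x * a⁻¹ ∈ Subgroup.zpowers x ∧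
      b * x * b⁻¹ ∈ Subgroup.zpowers x := by
    by_cases h : a * b = 1
    · have h' : b = a := by rw [eq_inv_of_mul_eq_one_right h, inv_eq_of_mul_eq_one_right ha]
      subst h'
      refine ⟨b, fun h ↦ ?_, by simp, by simp⟩
      rw [h, Set.pair_eq_singleton, Subgroup.closure_singleton_one] at hab
      exact bot_ne_top hab
    · have ha' := inv_eq_of_mul_eq_one_right ha
      have hb' := inv_eq_of_mul_eq_one_right hb
      refine ⟨a * b, h, ?_, ?_⟩
      · rw [show a * (a * b) * a⁻¹ = (a * b)⁻¹ by
          rw [mul_inv_rev, ← mul_assoc, ha, ha', hb', one_mul]]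
        exact inv_mem (Subgroup.mem_zpowers _)
      · rw [show b * (a * b) * b⁻¹ = (a * b)⁻¹ by
          rw [mul_inv_rev, ha', hb', mul_assoc, mul_assoc a b b, hb, mul_one]]
        exact inv_mem (Subgroup.mem_zpowers _)
  have hnorm : Subgroup.closure {a, b} ≤ Subgroup.normalizer (Subgroup.zpowers x : Set G) := by
    have hmem : ∀ c : G, c * c = 1 → c * x * c⁻¹ ∈ Subgroup.zpowers x →
        c ∈ Subgroup.normalizer (Subgroup.zpowers x : Set G) := by
      intro c hc hcx
      have hconj : ∀ y ∈ Subgroup.zpowers x, c * y * c⁻¹ ∈ Subgroup.zpowers x := by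
        rintro _ ⟨k, rfl⟩
        simpa only [conj_zpow] using zpow_mem hcx k
      refine Subgroup.mem_normalizer_iff.2 fun y ↦ ⟨hconj y, fun hy ↦ ?_⟩
      have := hconj _ hy
      rwa [← mul_assoc, ← mul_assoc, hc, one_mul, mul_assoc, ← mul_inv_rev, hc, inv_one,
        mul_one] at this
    rw [Subgroup.closure_le]
    rintro _ (rfl | rfl)
    · exact hmem _ ha hax
    · exact hmem _ hb hbx
  obtain ⟨c, d, hcd⟩ := hG.le_stabilizer_pair_of_conj_mem (H := ⊤) hx fun h _ ↦
    (Subgroup.mem_normalizer_iff.1 (hnorm (hab ▸ Subgroup.mem_top h)) x).1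
      (Subgroup.mem_zpowers x)
  exact hG.stabilizer_pair_ne_top c d (top_le_iff.1 hcd)

variable [Finite G]

theorem bddAbove_irred_lengths :
    BddAbove {n | ∃ g : Fin n → G, IsGenSeq g ∧ IsIrred g} := by
  refine ⟨Nat.card G, ?_⟩
  rintro n ⟨g, hg, hi⟩
  simpa using Nat.card_le_card_of_injective g (hi.injective hg)

/-- A finite simple group containing an involution has an irredundant generating sequence of
involutions. -/
theorem exists_isIrred_of_involution [IsSimpleGroup G] {t : G} (ht1 : t ≠ 1) (ht : t * t = 1) :
    ∃ (n : ℕ) (g : Fin n → G), IsGenSeq g ∧ IsIrred g ∧ ∀ i, g i * g i = 1 := by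
  classical
  have hex : ∃ (n : ℕ) (g : Fin n → G), IsGenSeq g ∧ ∀ i, g i * g i = 1 := by
    have htop : Subgroup.closure {x : G | x * x = 1} = ⊤ := by
      have hn : (Subgroup.closure {x : G | x * x = 1}).Normal := by
        refine ⟨fun x hx y ↦ ?_⟩
        induction hx using Subgroup.closure_induction with
        | mem x hx =>
          refine Subgroup.subset_closure ?_
          rw [Set.mem_ofPred_eq] at hx ⊢
          simp [mul_assoc, ← mul_assoc x x, hx]
        | one => simp
        | mul a b _ _ ha hb => simpa [mul_assoc] using mul_mem ha hb
        | inv a _ ha => simpa [mul_assoc] using inv_mem ha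
      refine hn.eq_bot_or_eq_top.resolve_left fun h ↦ ht1 ?_
      have : t ∈ Subgroup.closure {x : G | x * x = 1} := Subgroup.subset_closure ht
      rwa [h, Subgroup.mem_bot] at this
    obtain ⟨n, ⟨e⟩⟩ := Finite.exists_equiv_fin {x : G | x * x = 1}
    refine ⟨n, fun i ↦ (e.symm i : G), ?_, fun i ↦ (e.symm i).2⟩
    rw [IsGenSeq, ← htop]
    congr 1
    ext x
    exact ⟨fun ⟨i, hi⟩ ↦ hi ▸ (e.symm i).2, fun hx ↦ ⟨e ⟨x, hx⟩, by simp⟩⟩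
  obtain ⟨n, ⟨g, hg, hinv⟩, hmin⟩ : ∃ n, (∃ g : Fin n → G, IsGenSeq g ∧ ∀ i, g i * g i = 1) ∧
      ∀ m < n, ¬ ∃ g : Fin m → G, IsGenSeq g ∧ ∀ i, g i * g i = 1 :=
    ⟨Nat.find hex, Nat.find_spec hex, fun _ ↦ Nat.find_min hex⟩
  refine ⟨n, g, hg, fun i hi ↦ ?_, hinv⟩
  cases n with
  | zero => exact i.elim0
  | succ n =>
    refine hmin n n.lt_succ_self ⟨g ∘ i.succAbove, ?_, fun j ↦ hinv _⟩
    rw [IsGenSeq, Set.range_comp, Fin.range_succAbove]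
    exact hi

theorem IsMoebiusAction.replacementProperty {Ω : Type*} [MulAction G Ω] [IsSimpleGroup G]
    (hG : IsMoebiusAction G Ω) {t : G} (ht1 : t ≠ 1) (ht : t * t = 1) :
    ReplacementProperty G := by
  have h3 : 3 ≤ maxIrredLen G := by
    obtain ⟨n, g, hg, hi, hinv⟩ := exists_isIrred_of_involution ht1 ht
    exact (hG.three_le_of_isGenSeq hg hinv).trans
      (le_csSup bddAbove_irred_lengths ⟨g, hg, hi⟩)
  rw [ReplacementProperty]
  generalize maxIrredLen G = m at h3
  intro g hg hi x hx
  rcases h3.eq_or_lt with rfl | h4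
  · obtain ⟨i, h⟩ := hG.exists_sup_closure_eq_top (X := Subgroup.zpowers x) (by simpa using hx) g
      (by rw [show Subgroup.closure (Set.range g) = ⊤ from hg, sup_top_eq])
    refine ⟨i, ?_⟩
    rw [Subgroup.zpowers_eq_closure, ← Subgroup.closure_union] at h
    refine top_le_iff.1 (h.symm.le.trans (Subgroup.closure_mono ?_))
    rintro _ (rfl | ⟨j, hj, rfl⟩)
    · exact ⟨i, by simp⟩
    · exact ⟨j, by rw [Function.update_of_ne hj]⟩
  · exfalso
    let e : Fin 3 → Fin m := Fin.castLE h3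
    have hbot : Subgroup.closure (g '' {j | 3 ≤ (j : ℕ)}) ≠ ⊥ := by
      intro hbot
      have h1 : g ⟨3, h4⟩ = 1 := by
        rw [← Subgroup.mem_bot, ← hbot]
        exact Subgroup.subset_closure ⟨_, le_refl 3, rfl⟩
      refine hi ⟨3, h4⟩ (top_le_iff.1 (hg.symm.le.trans ?_))
      rw [Subgroup.closure_le]
      rintro _ ⟨j, rfl⟩
      by_cases hj : j = ⟨3, h4⟩
      · rw [hj, h1]
        exact one_mem _
      · exact Subgroup.subset_closure ⟨j, hj, rfl⟩
    have htop : Subgroup.closure (g '' {j | 3 ≤ (j : ℕ)}) ⊔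
        Subgroup.closure (Set.range (g ∘ e)) = ⊤ := by
      rw [← Subgroup.closure_union]
      refine top_le_iff.1 (hg.symm.le.trans (Subgroup.closure_mono ?_))
      rintro _ ⟨j, rfl⟩
      rcases lt_or_ge (j : ℕ) 3 with hj | hj
      · exact .inr ⟨⟨j, hj⟩, rfl⟩
      · exact .inl ⟨j, hj, rfl⟩
    obtain ⟨i, h⟩ := hG.exists_sup_closure_eq_top hbot (g ∘ e) htop
    refine hi (e i) (top_le_iff.1 (h.symm.le.trans ?_))
    rw [← Subgroup.closure_union]
    refine Subgroup.closure_mono ?_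
    rintro _ (⟨j, hj, rfl⟩ | ⟨j, hj, rfl⟩)
    · refine ⟨j, fun h ↦ ?_, rfl⟩
      rw [Set.mem_ofPred_eq, h] at hj
      exact absurd i.2 (not_lt.2 hj)
    · exact ⟨e j, fun h ↦ hj (Fin.castLE_injective h3 h), rfl⟩

end Generation

end Proof

theorem psl_replacement_property_of_mod (p : ℕ) [Fact p.Prime] (hp : 5 < p)
    (h8 : p % 8 = 3 ∨ p % 8 = 5) (h10 : p % 10 = 3 ∨ p % 10 = 7) :
    ReplacementProperty (PSL p) := by
  have hF2 : ¬ IsSquare (2 : ZMod p) := by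
    rw [ZMod.exists_sq_eq_two_iff (by omega)]
    omega
  have hF5 : ¬ IsSquare (5 : ZMod p) := by
    have h2 : ¬ IsSquare ((2 : ℕ) : ZMod 5) := by decide
    have h3 : ¬ IsSquare ((3 : ℕ) : ZMod 5) := by decide
    have : Fact (Nat.Prime 5) := ⟨by norm_num⟩
    have h := ZMod.exists_sq_eq_prime_iff_of_mod_four_eq_one (p := 5) (q := p) (by norm_num)
      (by omega)
    rw [Nat.cast_ofNat] at h
    rw [← h]
    have hmod : p % 5 = 2 ∨ p % 5 = 3 := by omega
    rw [← ZMod.natCast_mod p 5]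
    rcases hmod with h | h <;> rw [h] <;> assumption
  have : IsSimpleGroup (PSL p) :=
    Matrix.ProjectiveSpecialLinearGroup.rank_two_simple (by rw [Nat.card_zmod]; omega)
  have hdet : (!![0, 1; -1, 0] : Matrix (Fin 2) (Fin 2) (ZMod p)).det = 1 := by simp
  let T : Matrix.SpecialLinearGroup (Fin 2) (ZMod p) := ⟨_, hdet⟩
  have hT : (T : PSL p) ≠ 1 := by
    rw [Ne, Matrix.ProjectiveSpecialLinearGroup.coe_eq_one_iff]
    simp [T]
  exact (Matrix.ProjectiveSpecialLinearGroup.isMoebiusAction hF2 hF5).replacementProperty hT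
    (Matrix.ProjectiveSpecialLinearGroup.coe_mul_self_eq_one_iff.2 (.inr (by simp [T])))
end

section
/- Let p be a prime with p > 5 and p % 8 ∈ {1, 7} (i.e., p ≡ ±1 mod 8). Then there exist two distinct subgroups H and K of PSL(2,p), each isomorphic to the symmetric group S₄ (Equiv.Perm (Fin 4)), such that their intersection H ⊓ K is isomorphic to the symmetric group S₃ (Equiv.Perm (Fin 3)). -/
namespace Matrix

/-- The element `x` of `PSL(2, F)` is the image of the invertible matrix `M`, up to scalars. -/
def IsProjClass {F : Type*} [Field F] (x : ProjectiveSpecialLinearGroup (Fin 2) F)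
    (M : Matrix (Fin 2) (Fin 2) F) : Prop :=
  ∃ (A : SpecialLinearGroup (Fin 2) F) (c : F),
    c ≠ 0 ∧ (A : ProjectiveSpecialLinearGroup (Fin 2) F) = x ∧ M = c • (A : Matrix _ _ F)

variable {F : Type*} [Field F]

theorem ProjectiveSpecialLinearGroup.mk_eq_mk_iff {A B : SpecialLinearGroup (Fin 2) F} :
    (A : ProjectiveSpecialLinearGroup (Fin 2) F) = B ↔
      ∃ c : F, (A : Matrix (Fin 2) (Fin 2) F) = c • (B : Matrix (Fin 2) (Fin 2) F) := by
  rw [eq_comm, QuotientGroup.eq, SpecialLinearGroup.mem_center_iff]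
  constructor
  · rintro ⟨r, -, hr⟩
    refine ⟨r, ?_⟩
    have h : A = B * (B⁻¹ * A) := by group
    rw [h, SpecialLinearGroup.coe_mul, ← hr, scalar_apply, ← smul_one_eq_diagonal, mul_smul_comm,
      mul_one]
  · rintro ⟨c, hc⟩
    refine ⟨c, ?_, ?_⟩
    · simpa [det_smul] using (congrArg det hc).symm
    · rw [SpecialLinearGroup.coe_mul, hc, mul_smul_comm, ← SpecialLinearGroup.coe_mul,
        inv_mul_cancel, SpecialLinearGroup.coe_one, scalar_apply, smul_one_eq_diagonal]

theorem IsProjClass.eq_iff {x y : ProjectiveSpecialLinearGroup (Fin 2) F}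
    {M N : Matrix (Fin 2) (Fin 2) F} (hx : IsProjClass x M) (hy : IsProjClass y N) :
    x = y ↔ ∃ c : F, M = c • N := by
  obtain ⟨A, a, ha, rfl, rfl⟩ := hx
  obtain ⟨B, b, hb, rfl, rfl⟩ := hy
  rw [ProjectiveSpecialLinearGroup.mk_eq_mk_iff]
  constructor
  · rintro ⟨c, hc⟩
    refine ⟨a * c * b⁻¹, ?_⟩
    rw [hc, smul_smul, smul_smul, inv_mul_cancel_right₀ hb]
  · rintro ⟨c, hc⟩
    refine ⟨a⁻¹ * (c * b), ?_⟩
    rw [mul_smul, mul_smul, ← hc, inv_smul_smul₀ ha]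

theorem IsProjClass.mul {x y : ProjectiveSpecialLinearGroup (Fin 2) F}
    {M N : Matrix (Fin 2) (Fin 2) F} (hx : IsProjClass x M) (hy : IsProjClass y N) :
    IsProjClass (x * y) (M * N) := by
  obtain ⟨A, a, ha, rfl, rfl⟩ := hx
  obtain ⟨B, b, hb, rfl, rfl⟩ := hy
  refine ⟨A * B, a * b, mul_ne_zero ha hb, rfl, ?_⟩
  rw [SpecialLinearGroup.coe_mul, smul_mul_smul_comm]

theorem exists_isProjClass_of_det_eq {M : Matrix (Fin 2) (Fin 2) F} {d : F} (hd : d ≠ 0)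
    (hM : M.det = d ^ 2) : ∃ x, IsProjClass x M := by
  refine ⟨_, ⟨d⁻¹ • M, ?_⟩, d, hd, rfl, ?_⟩
  · rw [det_smul, hM, Fintype.card_fin, ← mul_pow, inv_mul_cancel₀ hd, one_pow]
  · exact (smul_inv_smul₀ hd M).symm

/-- A projective representation by matrices of nonzero square determinant induces a homomorphism
to `PSL(2, F)`. -/
theorem exists_monoidHom_isProjClass {G : Type*} [Group G] (Q : G → Matrix (Fin 2) (Fin 2) F)
    (hdet : ∀ g, ∃ d : F, d ≠ 0 ∧ (Q g).det = d ^ 2)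
    (hmul : ∀ g h, ∃ c : F, Q g * Q h = c • Q (g * h)) :
    ∃ f : G →* ProjectiveSpecialLinearGroup (Fin 2) F, ∀ g, IsProjClass (f g) (Q g) := by
  choose d hd hQ using hdet
  choose f hf using fun g => exists_isProjClass_of_det_eq (hd g) (hQ g)
  exact ⟨MonoidHom.mk' f fun g h =>
    (((hf g).mul (hf h)).eq_iff (hf (g * h))).2 (hmul g h) |>.symm, hf⟩

end Matrix

namespace Quaternion

/-- The coordinates of an integral quaternion. -/
def coords (x : ℍ[ℤ]) : Fin 4 → ℤ :=
  ![x.re, x.imI, x.imJ, x.imK]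

/-- `x` is a rational multiple of `y` (for `y ≠ 0`). -/
def Parallel (x y : ℍ[ℤ]) : Prop :=
  ∀ i, (y * star y).re * x.coords i = (x * star y).re * y.coords i

/-- `x` and `y` are linearly independent modulo every prime `p > 5`, as witnessed by a minor. -/
def Apart (x y : ℍ[ℤ]) : Prop :=
  ∃ i j, x.coords i * y.coords j - x.coords j * y.coords i ∣ 30 ^ 20

instance : DecidableRel Parallel := fun _ _ => by
  unfold Parallel
  infer_instance

instance : DecidableRel Apart := fun _ _ => by
  unfold Apart
  infer_instance

/-- The matrix of a quaternion, where `i` and `j` act by `!![a, b; b, -a]` and `!![0, -1; 1, 0]`. -/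
def toMatrix {R : Type*} [CommRing R] (a b : R) (x : ℍ[ℤ]) : Matrix (Fin 2) (Fin 2) R :=
  !![x.re + x.imI * a + x.imK * b, x.imI * b - x.imJ - x.imK * a;
    x.imI * b + x.imJ - x.imK * a, x.re - x.imI * a - x.imK * b]

section CommRing

variable {R : Type*} [CommRing R] {a b : R}

theorem toMatrix_mul (h : a ^ 2 + b ^ 2 = -1) (x y : ℍ[ℤ]) :
    toMatrix a b (x * y) = toMatrix a b x * toMatrix a b y := by
  ext i j
  fin_cases i <;> fin_cases j <;> simp [toMatrix]
  · linear_combination (-(x.imI * y.imI + x.imK * y.imK : R)) * h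
  · linear_combination (x.imI * y.imK - x.imK * y.imI : R) * h
  · linear_combination (x.imK * y.imI - x.imI * y.imK : R) * h
  · linear_combination (-(x.imI * y.imI + x.imK * y.imK : R)) * h

theorem det_toMatrix (h : a ^ 2 + b ^ 2 = -1) (x : ℍ[ℤ]) :
    (toMatrix a b x).det = ((x * star x).re : ℤ) := by
  rw [Matrix.det_fin_two]
  simp [toMatrix]
  linear_combination (-(x.imI ^ 2 + x.imK ^ 2 : R)) * h

end CommRing

section Field

variable {F : Type*} [Field F] {a b : F}

theorem Parallel.exists_toMatrix_eq_smul {x y : ℍ[ℤ]} (hxy : x.Parallel y)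
    (hy : (((y * star y).re : ℤ) : F) ≠ 0) : ∃ c : F, toMatrix a b x = c • toMatrix a b y := by
  have key (i) : (x.coords i : F) = ((x * star y).re : ℤ) / ((y * star y).re : ℤ) * y.coords i := by
    rw [div_mul_eq_mul_div, eq_div_iff hy, mul_comm]
    simpa using congrArg (Int.cast : ℤ → F) (hxy i)
  refine ⟨((x * star y).re : ℤ) / ((y * star y).re : ℤ), ?_⟩
  generalize (((x * star y).re : ℤ) : F) / ((y * star y).re : ℤ) = c at key ⊢
  have h0 : (x.re : F) = c * y.re := key 0
  have h1 : (x.imI : F) = c * y.imI := key 1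
  have h2 : (x.imJ : F) = c * y.imJ := key 2
  have h3 : (x.imK : F) = c * y.imK := key 3
  ext i j
  fin_cases i <;> fin_cases j <;> simp [toMatrix, h0, h1, h2, h3] <;> ring

theorem coords_eq_of_toMatrix_eq_smul (h : a ^ 2 + b ^ 2 = -1) (h2 : (2 : F) ≠ 0) {x y : ℍ[ℤ]}
    {c : F} (hxy : toMatrix a b x = c • toMatrix a b y) (i : Fin 4) :
    (x.coords i : F) = c * y.coords i := by
  have e00 := congrFun (congrFun hxy 0) 0
  have e01 := congrFun (congrFun hxy 0) 1
  have e10 := congrFun (congrFun hxy 1) 0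
  have e11 := congrFun (congrFun hxy 1) 1
  simp only [toMatrix, Matrix.smul_apply, Matrix.of_apply, Matrix.cons_val', Matrix.cons_val_zero,
    Matrix.cons_val_one, Matrix.cons_val_fin_one, smul_eq_mul] at e00 e01 e10 e11
  apply mul_left_cancel₀ h2
  fin_cases i <;> simp only [coords, Fin.zero_eta, Fin.mk_one, Fin.reduceFinMk, Matrix.cons_val]
  · linear_combination e00 + e11
  · linear_combination (-a) * (e00 - e11) - b * (e01 + e10) + 2 * (x.imI - c * y.imI) * h
  · linear_combination e10 - e01
  · linear_combination (-b) * (e00 - e11) + a * (e01 + e10) + 2 * (x.imK - c * y.imK) * h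

end Field

theorem Apart.toMatrix_ne_smul {p : ℕ} [Fact p.Prime] (hp : 5 < p) {a b : ZMod p}
    (h : a ^ 2 + b ^ 2 = -1) {x y : ℍ[ℤ]} (hxy : x.Apart y) (c : ZMod p) :
    toMatrix a b x ≠ c • toMatrix a b y := by
  intro hc
  have h2 : (2 : ZMod p) ≠ 0 := by
    intro h0
    have := Nat.le_of_dvd two_pos ((ZMod.natCast_eq_zero_iff 2 p).1 (by exact_mod_cast h0))
    lia
  obtain ⟨i, j, hij⟩ := hxy
  have hi := coords_eq_of_toMatrix_eq_smul h h2 hc i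
  have hj := coords_eq_of_toMatrix_eq_smul h h2 hc j
  have h0 : ((x.coords i * y.coords j - x.coords j * y.coords i : ℤ) : ZMod p) = 0 := by
    push_cast
    rw [hi, hj]
    ring
  have hdvd : (p : ℤ) ∣ 30 ^ 20 := ((ZMod.intCast_zmod_eq_zero_iff_dvd _ p).1 h0).trans hij
  have hdvd' : p ∣ 2 * 3 * 5 := Fact.out (p := p.Prime).dvd_of_dvd_pow (by exact_mod_cast hdvd)
  rw [Nat.Prime.dvd_mul Fact.out, Nat.Prime.dvd_mul Fact.out] at hdvd'
  rcases hdvd' with (hd | hd) | hd <;> have := Nat.le_of_dvd (by norm_num) hd <;> lia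

end Quaternion

section PermQuaternion

open Equiv Quaternion

/-- The vertices of a regular tetrahedron, as pure quaternions. -/
def tetrahedronVertex : Fin 4 → ℍ[ℤ] :=
  ![⟨0, 1, 1, 1⟩, ⟨0, 1, -1, -1⟩, ⟨0, -1, 1, -1⟩, ⟨0, -1, -1, 1⟩]

/-- A quaternion whose rotation is the negative of the reflection that swaps two vertices of the
tetrahedron. -/
def swapQuaternion (a b : Fin 4) : ℍ[ℤ] :=
  if a = b then 1 else tetrahedronVertex a - tetrahedronVertex b

/-- A quaternion representing a permutation `σ` of the four diagonals of the cube, obtained from a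
factorization of `σ` into transpositions. -/
def permQuaternion (σ : Perm (Fin 4)) : ℍ[ℤ] :=
  let τ := swap 0 (σ 0) * σ
  let υ := swap 1 (τ 1) * τ
  swapQuaternion 0 (σ 0) * swapQuaternion 1 (τ 1) * swapQuaternion 2 (υ 2)

/-- The conjugate of `permQuaternion σ` by the first vertex of the tetrahedron. -/
def conjPermQuaternion (σ : Perm (Fin 4)) : ℍ[ℤ] :=
  tetrahedronVertex 0 * permQuaternion σ * star (tetrahedronVertex 0)

theorem permQuaternion_mul_parallel : ∀ σ τ,
    (permQuaternion σ * permQuaternion τ).Parallel (permQuaternion (σ * τ)) := by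
  decide +kernel

theorem conjPermQuaternion_mul_parallel : ∀ σ τ,
    (conjPermQuaternion σ * conjPermQuaternion τ).Parallel (conjPermQuaternion (σ * τ)) := by
  decide +kernel

theorem permQuaternion_mul_star : ∀ σ, ∃ n : Fin 4,
    (permQuaternion σ * star (permQuaternion σ)).re = 8 ^ (n : ℕ) := by
  decide +kernel

theorem conjPermQuaternion_mul_star : ∀ σ, ∃ n : Fin 4,
    (conjPermQuaternion σ * star (conjPermQuaternion σ)).re = 3 ^ 2 * 8 ^ (n : ℕ) := by
  decide +kernel

theorem permQuaternion_apart : ∀ σ τ, σ ≠ τ →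
    (permQuaternion σ).Apart (permQuaternion τ) := by
  decide +kernel

theorem conjPermQuaternion_apart : ∀ σ τ, σ ≠ τ →
    (conjPermQuaternion σ).Apart (conjPermQuaternion τ) := by
  decide +kernel

theorem permQuaternion_parallel_conjPermQuaternion : ∀ σ, σ 0 = 0 →
    (permQuaternion σ).Parallel (conjPermQuaternion σ) := by
  decide +kernel

theorem permQuaternion_apart_conjPermQuaternion : ∀ σ τ, σ 0 ≠ 0 →
    (permQuaternion σ).Apart (conjPermQuaternion τ) := by
  decide +kernel

theorem extendDomainHom_finSuccAboveEquiv_apply_zero (τ : Perm (Fin 3)) :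
    Perm.extendDomainHom (finSuccAboveEquiv (0 : Fin 4)) τ 0 = 0 :=
  Perm.extendDomain_apply_not_subtype _ _ (by simp)

theorem exists_extendDomainHom_finSuccAboveEquiv_eq : ∀ σ : Perm (Fin 4), σ 0 = 0 →
    ∃ τ, Perm.extendDomainHom (finSuccAboveEquiv (0 : Fin 4)) τ = σ := by
  decide +kernel

end PermQuaternion

theorem psl_two_S4_intersect_in_S3 (p : ℕ) [Fact p.Prime] (hp : 5 < p)
    (h8 : p % 8 = 1 ∨ p % 8 = 7) :
    ∃ H K : Subgroup (PSL p), H ≠ K ∧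
      Nonempty (H ≃* Equiv.Perm (Fin 4)) ∧
      Nonempty (K ≃* Equiv.Perm (Fin 4)) ∧
      Nonempty ((H ⊓ K : Subgroup (PSL p)) ≃* Equiv.Perm (Fin 3)) := by
  obtain ⟨a, b, hab⟩ := ZMod.sq_add_sq p (-1)
  obtain ⟨s, hs⟩ := (ZMod.exists_sq_eq_two_iff (p := p) (by lia)).2 h8
  have h2 : (2 : ZMod p) ≠ 0 := by
    intro h0
    have := Nat.le_of_dvd two_pos ((ZMod.natCast_eq_zero_iff 2 p).1 (by exact_mod_cast h0))
    lia
  have h3 : (3 : ZMod p) ≠ 0 := by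
    intro h0
    have := Nat.le_of_dvd three_pos ((ZMod.natCast_eq_zero_iff 3 p).1 (by exact_mod_cast h0))
    lia
  have hs0 : s ≠ 0 := by
    rintro rfl
    exact h2 (by rw [hs, mul_zero])
  have h8s : (8 : ZMod p) = (2 * s) ^ 2 := by linear_combination 4 * hs
  have hnorm (σ) : ∃ d : ZMod p, d ≠ 0 ∧
      (((permQuaternion σ * star (permQuaternion σ)).re : ℤ) : ZMod p) = d ^ 2 := by
    obtain ⟨n, hn⟩ := permQuaternion_mul_star σ
    refine ⟨(2 * s) ^ (n : ℕ), pow_ne_zero _ (mul_ne_zero h2 hs0), ?_⟩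
    rw [hn]
    push_cast
    rw [h8s, pow_right_comm]
  have hnorm' (σ) : ∃ d : ZMod p, d ≠ 0 ∧
      (((conjPermQuaternion σ * star (conjPermQuaternion σ)).re : ℤ) : ZMod p) = d ^ 2 := by
    obtain ⟨n, hn⟩ := conjPermQuaternion_mul_star σ
    refine ⟨3 * (2 * s) ^ (n : ℕ), mul_ne_zero h3 (pow_ne_zero _ (mul_ne_zero h2 hs0)), ?_⟩
    rw [hn]
    push_cast
    rw [h8s, pow_right_comm]
    ring
  have hne (σ) : (((permQuaternion σ * star (permQuaternion σ)).re : ℤ) : ZMod p) ≠ 0 := by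
    obtain ⟨d, hd, h⟩ := hnorm σ
    rw [h]
    exact pow_ne_zero _ hd
  have hne' (σ) :
      (((conjPermQuaternion σ * star (conjPermQuaternion σ)).re : ℤ) : ZMod p) ≠ 0 := by
    obtain ⟨d, hd, h⟩ := hnorm' σ
    rw [h]
    exact pow_ne_zero _ hd
  obtain ⟨f, hf⟩ := Matrix.exists_monoidHom_isProjClass
    (fun σ => Quaternion.toMatrix a b (permQuaternion σ))
    (fun σ => by simpa only [Quaternion.det_toMatrix hab] using hnorm σ)
    (fun σ τ => by
      rw [← Quaternion.toMatrix_mul hab]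
      exact (permQuaternion_mul_parallel σ τ).exists_toMatrix_eq_smul (hne _))
  obtain ⟨g, hg⟩ := Matrix.exists_monoidHom_isProjClass
    (fun σ => Quaternion.toMatrix a b (conjPermQuaternion σ))
    (fun σ => by simpa only [Quaternion.det_toMatrix hab] using hnorm' σ)
    (fun σ τ => by
      rw [← Quaternion.toMatrix_mul hab]
      exact (conjPermQuaternion_mul_parallel σ τ).exists_toMatrix_eq_smul (hne' _))
  have hfinj : Function.Injective f := by
    intro σ τ h
    by_contra hστ
    obtain ⟨c, hc⟩ := ((hf σ).eq_iff (hf τ)).1 h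
    exact (permQuaternion_apart σ τ hστ).toMatrix_ne_smul hp hab c hc
  have hginj : Function.Injective g := by
    intro σ τ h
    by_contra hστ
    obtain ⟨c, hc⟩ := ((hg σ).eq_iff (hg τ)).1 h
    exact (conjPermQuaternion_apart σ τ hστ).toMatrix_ne_smul hp hab c hc
  have hfg (σ) (h : σ 0 = 0) : f σ = g σ := ((hf σ).eq_iff (hg σ)).2 <|
    (permQuaternion_parallel_conjPermQuaternion σ h).exists_toMatrix_eq_smul (hne' _)
  have hfix (σ τ) (h : f σ = g τ) : σ 0 = 0 := by
    by_contra h0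
    obtain ⟨c, hc⟩ := ((hf σ).eq_iff (hg τ)).1 h
    exact (permQuaternion_apart_conjPermQuaternion σ τ h0).toMatrix_ne_smul hp hab c hc
  set ι := Equiv.Perm.extendDomainHom (finSuccAboveEquiv (0 : Fin 4))
  have hinf : f.range ⊓ g.range = (f.comp ι).range := by
    ext x
    constructor
    · rintro ⟨⟨σ, rfl⟩, ⟨τ, hτ⟩⟩
      obtain ⟨υ, rfl⟩ := exists_extendDomainHom_finSuccAboveEquiv_eq σ (hfix σ τ hτ.symm)
      exact ⟨υ, rfl⟩
    · rintro ⟨υ, rfl⟩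
      exact ⟨⟨ι υ, rfl⟩, ι υ, (hfg _ (extendDomainHom_finSuccAboveEquiv_apply_zero υ)).symm⟩
  have hιinj : Function.Injective (f.comp ι) :=
    hfinj.comp (Equiv.Perm.extendDomainHom_injective _)
  refine ⟨f.range, g.range, fun h => ?_, ⟨(MonoidHom.ofInjective hfinj).symm⟩,
    ⟨(MonoidHom.ofInjective hginj).symm⟩, ⟨?_⟩⟩
  · have hmem : f (Equiv.swap 0 1) ∈ g.range := h ▸ ⟨_, rfl⟩
    obtain ⟨τ, hτ⟩ := hmem
    exact absurd (hfix _ τ hτ.symm) (by decide)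
  · exact (MulEquiv.subgroupCongr hinf).trans (MonoidHom.ofInjective hιinj).symm
end

section
/- Let p be a prime with p > 5 and p % 10 ∈ {1, 9} (i.e., p ≡ ±1 mod 10). Then there exist two distinct subgroups H and K of PSL(2,p), each isomorphic to the alternating group A₅ (alternatingGroup (Fin 5)), such that their intersection H ⊓ K is isomorphic to the dihedral group of order 10 (DihedralGroup 5). -/
/-- Relations between elements `c`, `i`, `j`, `w` of a group which allow every element of
`⟨c, w⟩` to be written as `c ^ a * (i ^ b * j ^ d * w ^ e)`, with `a < 5`, `b, d < 2`, `e < 3`.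
They hold for suitable elements of `A₅`. -/
structure IcosahedralRelations {G : Type*} [Group G] (c i j w : G) : Prop where
  c_pow : c ^ 5 = 1
  w_pow : w ^ 3 = 1
  i_sq : i ^ 2 = 1
  j_sq : j ^ 2 = 1
  ij : i * j = j * i
  wi : w * i = j * w
  wj : w * j = i * j * w
  wc : w * c = c ^ 4 * w ^ 2
  wc2 : w * c ^ 2 = c ^ 2 * i * w ^ 2
  wc3 : w * c ^ 3 = c * j * w
  wc4 : w * c ^ 4 = c ^ 3 * i

namespace IcosahedralRelations

variable {G G' : Type*} [Group G] [Group G'] {c i j w : G} {c' i' j' w' : G'}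

theorem prod (h : IcosahedralRelations c i j w) (h' : IcosahedralRelations c' i' j' w') :
    IcosahedralRelations (c, c') (i, i') (j, j') (w, w') where
  c_pow := Prod.ext h.c_pow h'.c_pow
  w_pow := Prod.ext h.w_pow h'.w_pow
  i_sq := Prod.ext h.i_sq h'.i_sq
  j_sq := Prod.ext h.j_sq h'.j_sq
  ij := Prod.ext h.ij h'.ij
  wi := Prod.ext h.wi h'.wi
  wj := Prod.ext h.wj h'.wj
  wc := Prod.ext h.wc h'.wc
  wc2 := Prod.ext h.wc2 h'.wc2
  wc3 := Prod.ext h.wc3 h'.wc3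
  wc4 := Prod.ext h.wc4 h'.wc4

/-- The element of the group with exponents `x` in normal form. -/
def normalForm (c i j w : G) (x : Fin 5 × Fin 2 × Fin 2 × Fin 3) : G :=
  c ^ (x.1 : ℕ) * (i ^ (x.2.1 : ℕ) * j ^ (x.2.2.1 : ℕ) * w ^ (x.2.2.2 : ℕ))

theorem c_mul_mem (h : IcosahedralRelations c i j w) {g : G}
    (hg : g ∈ Set.range (normalForm c i j w)) : c * g ∈ Set.range (normalForm c i j w) := by
  obtain ⟨⟨a, x⟩, rfl⟩ := hg
  refine ⟨(a + 1, x), ?_⟩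
  have : c ^ ((a + 1 : Fin 5) : ℕ) = c * c ^ (a : ℕ) := by
    rw [← pow_succ', Fin.val_add, Fin.val_one, ← pow_eq_pow_mod _ h.c_pow]
  simp only [normalForm, this, mul_assoc]

theorem w_mul_mem (h : IcosahedralRelations c i j w) {g : G}
    (hg : g ∈ Set.range (normalForm c i j w)) : w * g ∈ Set.range (normalForm c i j w) := by
  have hi : i * i = 1 := by rw [← pow_two, h.i_sq]
  have hj : j * j = 1 := by rw [← pow_two, h.j_sq]
  have hw : w * (w * w) = 1 := by rw [← h.w_pow, pow_succ', pow_two]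
  have hji := h.ij.symm
  have hi' (x : G) : i * (i * x) = x := by rw [← mul_assoc, hi, one_mul]
  have hj' (x : G) : j * (j * x) = x := by rw [← mul_assoc, hj, one_mul]
  have hw' (x : G) : w * (w * (w * x)) = x := by
    rw [← mul_assoc, ← mul_assoc, mul_assoc w, hw, one_mul]
  have hji' (x : G) : j * (i * x) = i * (j * x) := by rw [← mul_assoc, hji, mul_assoc]
  have hwi := h.wi
  have hwj : w * j = i * (j * w) := by rw [h.wj, mul_assoc]
  have hwi' (x : G) : w * (i * x) = j * (w * x) := by rw [← mul_assoc, hwi, mul_assoc]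
  have hwj' (x : G) : w * (j * x) = i * (j * (w * x)) := by
    rw [← mul_assoc, hwj, mul_assoc, mul_assoc]
  have key (a : Fin 5) : ∃ (a' : Fin 5) (b d : Fin 2) (e : Fin 3),
      w * c ^ (a : ℕ) = c ^ (a' : ℕ) * (i ^ (b : ℕ) * j ^ (d : ℕ) * w ^ (e : ℕ)) := by
    fin_cases a
    · exact ⟨0, 0, 0, 1, by simp⟩
    · exact ⟨4, 0, 0, 2, by simpa using h.wc⟩
    · exact ⟨2, 1, 0, 2, by simpa [mul_assoc] using h.wc2⟩
    · exact ⟨1, 0, 1, 1, by simpa [mul_assoc] using h.wc3⟩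
    · exact ⟨3, 1, 0, 0, by simpa using h.wc4⟩
  let A : Set G := Set.range fun x : Fin 2 × Fin 2 × Fin 3 ↦
    i ^ (x.1 : ℕ) * j ^ (x.2.1 : ℕ) * w ^ (x.2.2 : ℕ)
  have hiA : ∀ x ∈ A, i * x ∈ A := by
    rintro _ ⟨⟨b, d, e⟩, rfl⟩
    refine ⟨(b + 1, d, e), ?_⟩
    fin_cases b <;> simp [mul_assoc, hi']
  have hjA : ∀ x ∈ A, j * x ∈ A := by
    rintro _ ⟨⟨b, d, e⟩, rfl⟩
    refine ⟨(b, d + 1, e), ?_⟩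
    fin_cases b <;> fin_cases d <;> simp [mul_assoc, hj', hji']
  have hwA : ∀ x ∈ A, w * x ∈ A := by
    rintro _ ⟨⟨b, d, e⟩, rfl⟩
    refine ⟨(d, b + d, e + 1), ?_⟩
    fin_cases b <;> fin_cases d <;> fin_cases e <;>
      simp [mul_assoc, pow_two, hw, hj, hwi', hwj', hj', hji', hwj, hwi]
  have hpow {y : G} (hy : ∀ x ∈ A, y * x ∈ A) (n : ℕ) : ∀ x ∈ A, y ^ n * x ∈ A := by
    induction n with
    | zero => simp
    | succ n ih => intro x hx; rw [pow_succ', mul_assoc]; exact hy _ (ih _ hx)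
  obtain ⟨⟨a, x⟩, rfl⟩ := hg
  obtain ⟨a', b, d, e, ha⟩ := key a
  obtain ⟨y, hy⟩ := hpow hiA b _ (hpow hjA d _ (hpow hwA e _ ⟨x, rfl⟩))
  refine ⟨(a', y), ?_⟩
  simp only [normalForm, mul_assoc] at hy ⊢
  rw [hy, ← mul_assoc w, ha]
  simp only [mul_assoc]

theorem closure_subset_range (h : IcosahedralRelations c i j w) :
    (Subgroup.closure {c, w} : Set G) ⊆ Set.range (normalForm c i j w) := by
  intro g hg
  induction hg using Subgroup.closure_induction_left with
  | one => exact ⟨0, by simp [normalForm]⟩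
  | mul_left x hx y _ ih =>
    rcases hx with rfl | rfl
    · exact h.c_mul_mem ih
    · exact h.w_mul_mem ih
  | inv_mul_cancel x hx y _ ih =>
    rcases hx with rfl | rfl
    · rw [inv_eq_of_mul_eq_one_right (b := x ^ 4) (by rw [← pow_succ', h.c_pow])]
      simp only [pow_succ', pow_zero, mul_one, mul_assoc]
      exact h.c_mul_mem (h.c_mul_mem (h.c_mul_mem (h.c_mul_mem ih)))
    · rw [inv_eq_of_mul_eq_one_right (b := x ^ 2) (by rw [← pow_succ', h.w_pow])]
      simp only [pow_two, mul_assoc]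
      exact h.w_mul_mem (h.w_mul_mem ih)

theorem card_closure_le (h : IcosahedralRelations c i j w) :
    Finite (Subgroup.closure {c, w}) ∧ Nat.card (Subgroup.closure {c, w}) ≤ 60 := by
  have hfin : (Set.range (normalForm c i j w)).Finite := Set.finite_range _
  refine ⟨hfin.subset h.closure_subset_range, ?_⟩
  refine (Nat.card_mono hfin h.closure_subset_range).trans ?_
  refine (Finite.card_range_le _).trans ?_
  simp

end IcosahedralRelations

section AlternatingGroup

open Equiv

/-- The five-cycle playing the role of `c` in `A₅`. -/
def a5c : alternatingGroup (Fin 5) := ⟨c[0, 1, 2, 3, 4], Perm.mem_alternatingGroup.2 (by decide)⟩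

/-- The involution playing the role of `i` in `A₅`. -/
def a5i : alternatingGroup (Fin 5) := ⟨c[1, 2] * c[3, 4], Perm.mem_alternatingGroup.2 (by decide)⟩

/-- The involution playing the role of `j` in `A₅`. -/
def a5j : alternatingGroup (Fin 5) := ⟨c[1, 3] * c[2, 4], Perm.mem_alternatingGroup.2 (by decide)⟩

/-- The three-cycle playing the role of `w` in `A₅`. -/
def a5w : alternatingGroup (Fin 5) := ⟨c[1, 4, 3], Perm.mem_alternatingGroup.2 (by decide)⟩

theorem icosahedralRelations_a5 : IcosahedralRelations a5c a5i a5j a5w := by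
  constructor <;> decide +kernel

theorem eq_a5j_of_pow_eq_one (y : alternatingGroup (Fin 5)) (h1 : y ^ 2 = 1)
    (h2 : (a5i * a5j * y) ^ 2 = 1)
    (h3 : (a5c ^ 2 * y) ^ 3 = 1) : y = a5j := by
  revert y; decide +kernel

/-- The dihedral subgroup of `A₅` generated by `a5c` and `a5i * a5j`. -/
def dihedralToA5 : DihedralGroup 5 →* alternatingGroup (Fin 5) where
  toFun
    | .r n => a5c ^ n.val
    | .sr n => a5i * a5j * a5c ^ n.val
  map_one' := by decide
  map_mul' := by decide

theorem dihedralToA5_injective : Function.Injective dihedralToA5 := by decide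

theorem nat_card_alternatingGroup_fin_five : Nat.card (alternatingGroup (Fin 5)) = 60 := by
  rw [nat_card_alternatingGroup, Nat.card_fin]
  rfl

theorem five_le_index_of_ne_top (M : Subgroup (alternatingGroup (Fin 5))) (hM : M ≠ ⊤) :
    5 ≤ M.index := by
  by_contra! hlt
  have hcore : M.normalCore = ⊥ :=
    (Subgroup.Normal.eq_bot_or_eq_top inferInstance).resolve_right fun h ↦
      hM (top_le_iff.1 (h ▸ M.normalCore_le))
  rw [Subgroup.normalCore_eq_ker, MonoidHom.ker_eq_bot_iff] at hcore
  have hle := Nat.card_le_card_of_injective _ hcore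
  rw [Nat.card_perm, ← Subgroup.index_eq_card, nat_card_alternatingGroup_fin_five] at hle
  have := Nat.factorial_le (Nat.le_of_lt_succ hlt)
  simp [Nat.factorial] at hle this
  omega

theorem closure_a5c_a5w : Subgroup.closure {a5c, a5w} = ⊤ := by
  by_contra hne
  have hidx := five_le_index_of_ne_top _ hne
  have hmul := (Subgroup.closure {a5c, a5w}).card_mul_index
  rw [nat_card_alternatingGroup_fin_five] at hmul
  have : Fact (Nat.Prime 5) := ⟨by norm_num⟩
  have hc : orderOf a5c = 5 := orderOf_eq_prime icosahedralRelations_a5.c_pow (by decide)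
  have hw : orderOf a5w = 3 := orderOf_eq_prime icosahedralRelations_a5.w_pow (by decide)
  have h5 := hc ▸ Subgroup.orderOf_dvd_natCard (Subgroup.closure {a5c, a5w})
    (Subgroup.subset_closure (Set.mem_insert a5c _))
  have h3 := hw ▸ Subgroup.orderOf_dvd_natCard (Subgroup.closure {a5c, a5w})
    (Subgroup.subset_closure (Set.mem_insert_of_mem a5c rfl))
  obtain ⟨n, hn⟩ := (Nat.Coprime.mul_dvd_of_dvd_of_dvd (by decide) h5 h3 : 5 * 3 ∣ _)
  rw [hn] at hmul
  have : n ≠ 0 := by rintro rfl; simp at hmul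
  nlinarith [Nat.pos_of_ne_zero this]

theorem exists_hom_of_icosahedralRelations {G : Type*} [Group G] {c i j w : G}
    (h : IcosahedralRelations c i j w) :
    ∃ φ : alternatingGroup (Fin 5) →* G, φ a5c = c ∧ φ a5i = i ∧ φ a5j = j := by
  suffices ∃ φ : alternatingGroup (Fin 5) →* G, φ a5c = c ∧ φ a5w = w by
    obtain ⟨φ, hc, hw⟩ := this
    have hi := congrArg φ icosahedralRelations_a5.wc4
    simp only [map_mul, map_pow, hc, hw, h.wc4, mul_right_inj] at hi
    have hj := congrArg φ icosahedralRelations_a5.wi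
    simp only [map_mul, hw, ← hi, h.wi, mul_left_inj] at hj
    exact ⟨φ, hc, hi.symm, hj.symm⟩
  let Γ := Subgroup.closure {(a5c, c), (a5w, w)}
  obtain ⟨hfin, hcard⟩ := (icosahedralRelations_a5.prod h).card_closure_le
  let π : Γ →* alternatingGroup (Fin 5) := (MonoidHom.fst _ G).comp Γ.subtype
  have hc : (a5c, c) ∈ Γ := Subgroup.subset_closure (Set.mem_insert _ _)
  have hw : (a5w, w) ∈ Γ := Subgroup.subset_closure (Set.mem_insert_of_mem _ rfl)
  have hsurj : Function.Surjective π := by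
    rw [← MonoidHom.range_eq_top, ← top_le_iff, ← closure_a5c_a5w, Subgroup.closure_le]
    rintro _ (rfl | rfl)
    · exact ⟨⟨_, hc⟩, rfl⟩
    · exact ⟨⟨_, hw⟩, rfl⟩
  have hbij : Function.Bijective π :=
    hsurj.bijective_of_nat_card_le (hcard.trans_eq nat_card_alternatingGroup_fin_five.symm)
  let e := MulEquiv.ofBijective π hbij
  refine ⟨((MonoidHom.snd _ G).comp Γ.subtype).comp e.symm.toMonoidHom, ?_, ?_⟩
  · have : e.symm a5c = ⟨_, hc⟩ := e.symm_apply_eq.2 rfl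
    simp [this]
  · have : e.symm a5w = ⟨_, hw⟩ := e.symm_apply_eq.2 rfl
    simp [this]

theorem range_ne_and_inf_range_mulEquiv {G : Type*} [Group G]
    {φ ψ : alternatingGroup (Fin 5) →* G}
    (hc : φ a5c = ψ a5c) (hk : φ (a5i * a5j) = ψ (a5i * a5j)) (hk1 : φ (a5i * a5j) ≠ 1)
    (hj : φ a5j ≠ ψ a5j) :
    φ.range ≠ ψ.range ∧ Nonempty (φ.range ≃* alternatingGroup (Fin 5)) ∧
      Nonempty (ψ.range ≃* alternatingGroup (Fin 5)) ∧
      Nonempty ((φ.range ⊓ ψ.range : Subgroup G) ≃* DihedralGroup 5) := by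
  have inj {χ : alternatingGroup (Fin 5) →* G} (h : χ (a5i * a5j) ≠ 1) :
      Function.Injective χ := by
    rw [← MonoidHom.ker_eq_bot_iff]
    refine (Subgroup.Normal.eq_bot_or_eq_top inferInstance).resolve_right fun htop ↦ h ?_
    rw [← MonoidHom.mem_ker, htop]
    trivial
  have hφ := inj hk1
  have hψ := inj (hk ▸ hk1)
  have hM : ψ.range.comap φ ≠ ⊤ := by
    intro htop
    obtain ⟨y, hy⟩ : a5j ∈ ψ.range.comap φ := htop ▸ trivial
    refine hj (hy ▸ congrArg ψ ?_)
    refine eq_a5j_of_pow_eq_one y ?_ ?_ ?_ <;> apply hψ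
    · rw [map_pow, hy, ← map_pow, map_one, ← φ.map_one]
      exact congrArg φ (by decide +kernel)
    · rw [map_pow, map_mul, hy, ← hk, ← map_mul, ← map_pow, map_one, ← φ.map_one]
      exact congrArg φ (by decide +kernel)
    · rw [map_pow, map_mul, map_pow, hy, ← hc, ← map_pow, ← map_mul, ← map_pow, map_one,
        ← φ.map_one]
      exact congrArg φ (by decide +kernel)
  have hδ (d : DihedralGroup 5) : φ (dihedralToA5 d) = ψ (dihedralToA5 d) := by
    rcases d with n | n
    · change φ (a5c ^ n.val) = ψ (a5c ^ n.val)
      rw [map_pow, map_pow, hc]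
    · change φ (a5i * a5j * a5c ^ n.val) = ψ (a5i * a5j * a5c ^ n.val)
      rw [map_mul, map_mul ψ, map_pow, map_pow, hc, hk]
  have hle : dihedralToA5.range ≤ ψ.range.comap φ := by
    rintro _ ⟨d, rfl⟩
    exact ⟨dihedralToA5 d, (hδ d).symm⟩
  have hcard : Nat.card dihedralToA5.range = 10 := by
    rw [← Nat.card_congr (MonoidHom.ofInjective dihedralToA5_injective).toEquiv,
      DihedralGroup.nat_card]
  have heq : dihedralToA5.range = ψ.range.comap φ := by
    refine Subgroup.eq_of_le_of_card_ge hle ?_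
    obtain ⟨n, hn⟩ := hcard ▸ Subgroup.card_dvd_of_le hle
    have hmul := (ψ.range.comap φ).card_mul_index
    have hidx := five_le_index_of_ne_top _ hM
    rw [nat_card_alternatingGroup_fin_five, hn] at hmul
    have : n < 2 := by by_contra! h; nlinarith
    rw [hcard, hn]
    omega
  refine ⟨fun h ↦ hM ?_, ⟨(MonoidHom.ofInjective hφ).symm⟩, ⟨(MonoidHom.ofInjective hψ).symm⟩, ?_⟩
  · rw [← h, eq_top_iff]
    exact fun x _ ↦ ⟨x, rfl⟩
  · have : (φ.range ⊓ ψ.range : Subgroup G) = (φ.comp dihedralToA5).range := by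
      rw [MonoidHom.range_comp, heq, Subgroup.map_comap_eq]
    rw [this]
    exact ⟨(MonoidHom.ofInjective (f := φ.comp dihedralToA5)
      (hφ.comp dihedralToA5_injective)).symm⟩

end AlternatingGroup

section Quaternion

open Quaternion

theorem Quaternion.mem_unitary_iff {R : Type*} [CommRing R] {x : ℍ[R]} :
    x ∈ unitary ℍ[R] ↔ normSq x = 1 := by
  rw [Unitary.mem_iff, star_mul_self, self_mul_star, and_self, ← coe_one, coe_inj]

/-- Conjugation by a unit, as an endomorphism of the group of unit quaternions. -/
def Quaternion.unitaryConj {R : Type*} [CommRing R] (u : ℍ[R]ˣ) :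
    unitary ℍ[R] →* unitary ℍ[R] where
  toFun x := ⟨u * x * ↑u⁻¹, by
    have hx := mem_unitary_iff.1 x.2
    rw [mem_unitary_iff, map_mul, map_mul, hx, mul_one, ← map_mul, u.mul_inv, map_one]⟩
  map_one' := by simp
  map_mul' x y := by ext1; simp [mul_assoc]

/-- The `2 × 2` matrix attached to a quaternion by a solution of `a ^ 2 + b ^ 2 = -1`. -/
def splitMatrix {R : Type*} [CommRing R] (a b : R) (x : ℍ[R]) : Matrix (Fin 2) (Fin 2) R :=
  !![x.re + a * x.imJ - b * x.imK, -x.imI + b * x.imJ + a * x.imK;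
    x.imI + b * x.imJ + a * x.imK, x.re - a * x.imJ + b * x.imK]

theorem splitMatrix_mul {R : Type*} [CommRing R] {a b : R} (hab : a ^ 2 + b ^ 2 = -1)
    (x y : ℍ[R]) : splitMatrix a b (x * y) = splitMatrix a b x * splitMatrix a b y := by
  ext i j
  fin_cases i <;> fin_cases j <;> simp [splitMatrix] <;> grind

/-- The homomorphism from unit quaternions to `SL₂` given by `splitMatrix`. -/
def unitaryToSL {R : Type*} [CommRing R] {a b : R} (hab : a ^ 2 + b ^ 2 = -1) :
    unitary ℍ[R] →* Matrix.SpecialLinearGroup (Fin 2) R where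
  toFun x := ⟨splitMatrix a b x, by
    have hx := mem_unitary_iff.1 x.2
    rw [normSq_def'] at hx
    rw [splitMatrix, Matrix.det_fin_two_of]
    grind⟩
  map_one' := by
    ext i j
    fin_cases i <;> fin_cases j <;> simp [splitMatrix]
  map_mul' x y := Subtype.ext (splitMatrix_mul hab x y)

theorem coe_unitaryToSL {R : Type*} [CommRing R] {a b : R} (hab : a ^ 2 + b ^ 2 = -1)
    (x : unitary ℍ[R]) :
    (unitaryToSL hab x : Matrix (Fin 2) (Fin 2) R) = splitMatrix a b x := rfl

/-- The homomorphism from unit quaternions to `PSL₂` given by `splitMatrix`. -/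
def unitaryToPSL {R : Type*} [CommRing R] {a b : R} (hab : a ^ 2 + b ^ 2 = -1) :
    unitary ℍ[R] →* Matrix.ProjectiveSpecialLinearGroup (Fin 2) R :=
  (QuotientGroup.mk' _).comp (unitaryToSL hab)

theorem exists_smul_eq_of_unitaryToPSL_eq {R : Type*} [CommRing R] {a b : R}
    (hab : a ^ 2 + b ^ 2 = -1) {x y : unitary ℍ[R]} (h : unitaryToPSL hab x = unitaryToPSL hab y) :
    ∃ r : R, splitMatrix a b y = r • splitMatrix a b x := by
  rw [unitaryToPSL, MonoidHom.comp_apply, MonoidHom.comp_apply, QuotientGroup.mk'_apply,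
    QuotientGroup.mk'_apply, QuotientGroup.eq, Matrix.SpecialLinearGroup.mem_center_iff] at h
  obtain ⟨r, -, hr⟩ := h
  refine ⟨r, ?_⟩
  change (unitaryToSL hab y : Matrix (Fin 2) (Fin 2) R) =
    r • (unitaryToSL hab x : Matrix (Fin 2) (Fin 2) R)
  rw [← mul_inv_cancel_left (unitaryToSL hab x) (unitaryToSL hab y),
    Matrix.SpecialLinearGroup.coe_mul, ← hr, Matrix.scalar_apply, ← Matrix.smul_one_eq_diagonal,
    Matrix.mul_smul, mul_one]

theorem unitaryToPSL_neg_one {R : Type*} [CommRing R] {a b : R} (hab : a ^ 2 + b ^ 2 = -1) :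
    unitaryToPSL hab (-1) = 1 := by
  rw [unitaryToPSL, MonoidHom.comp_apply, QuotientGroup.mk'_apply, QuotientGroup.eq_one_iff,
    Matrix.SpecialLinearGroup.mem_center_iff]
  refine ⟨-1, by simp, ?_⟩
  ext i j
  fin_cases i <;> fin_cases j <;> simp [coe_unitaryToSL, splitMatrix, Unitary.coe_neg]

/-- A quaternion with prescribed coordinates and norm one. -/
def unitQuaternion {R : Type*} [CommRing R] (x y z t : R)
    (h : x ^ 2 + y ^ 2 + z ^ 2 + t ^ 2 = 1) : unitary ℍ[R] :=
  ⟨⟨x, y, z, t⟩, mem_unitary_iff.2 ((normSq_def' _).trans h)⟩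

section
variable {R : Type*} [CommRing R] (x y z t : R) (h : x ^ 2 + y ^ 2 + z ^ 2 + t ^ 2 = 1)

@[simp] theorem unitQuaternion_re : (unitQuaternion x y z t h : ℍ[R]).re = x := rfl
@[simp] theorem unitQuaternion_imI : (unitQuaternion x y z t h : ℍ[R]).imI = y := rfl
@[simp] theorem unitQuaternion_imJ : (unitQuaternion x y z t h : ℍ[R]).imJ = z := rfl
@[simp] theorem unitQuaternion_imK : (unitQuaternion x y z t h : ℍ[R]).imK = t := rfl
end

/-- The quaternion `τ i + j`. -/
def conjQuaternion {R : Type*} [CommRing R] (τ : R) : ℍ[R] := ⟨0, τ, 1, 0⟩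

section
variable {R : Type*} [CommRing R] (τ : R)

@[simp] theorem conjQuaternion_re : (conjQuaternion τ).re = 0 := rfl
@[simp] theorem conjQuaternion_imI : (conjQuaternion τ).imI = τ := rfl
@[simp] theorem conjQuaternion_imJ : (conjQuaternion τ).imJ = 1 := rfl
@[simp] theorem conjQuaternion_imK : (conjQuaternion τ).imK = 0 := rfl
end

section
variable {F : Type*} [Field F] {τ : F}

/-- The quaternion `i`. -/
def unitI : unitary ℍ[F] := unitQuaternion 0 1 0 0 (by simp)

/-- The quaternion `j`. -/
def unitJ : unitary ℍ[F] := unitQuaternion 0 0 1 0 (by simp)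

/-- `τ i + j` as a unit. -/
def conjUnit (hτ : τ ^ 2 = τ + 1) (h : τ + 2 ≠ 0) : ℍ[F]ˣ where
  val := conjQuaternion τ
  inv := (-(τ + 2)⁻¹) • conjQuaternion τ
  val_inv := by ext <;> simp; grind
  inv_val := by ext <;> simp; grind

theorem coe_conjUnit (hτ : τ ^ 2 = τ + 1) (h : τ + 2 ≠ 0) :
    (conjUnit hτ h : ℍ[F]) = conjQuaternion τ := rfl

theorem unitaryConj_unitI_mul_unitJ (hτ : τ ^ 2 = τ + 1) (h : τ + 2 ≠ 0) :
    unitaryConj (conjUnit hτ h) (unitI * unitJ) = -1 * (unitI * unitJ) := by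
  apply Subtype.ext
  change (conjUnit hτ h : ℍ[F]) * _ * ↑(conjUnit hτ h)⁻¹ = _
  rw [Units.mul_inv_eq_iff_eq_mul]
  ext <;> simp [unitI, unitJ, coe_conjUnit, Unitary.coe_neg]

variable [NeZero (2 : F)]

/-- The quaternion `(1 + i + j + k) / 2`, of order six. -/
def unitW : unitary ℍ[F] := unitQuaternion (1 / 2) (1 / 2) (1 / 2) (1 / 2) (by
  have : (2 : F) ≠ 0 := NeZero.ne 2
  grind)

/-- The quaternion `(τ + i + (τ - 1) j) / 2`, of order ten. -/
def unitC (hτ : τ ^ 2 = τ + 1) : unitary ℍ[F] :=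
  unitQuaternion (τ / 2) (1 / 2) ((τ - 1) / 2) 0 (by
    have : (2 : F) ≠ 0 := NeZero.ne 2
    grind)

theorem unitC_sq_coords (hτ : τ ^ 2 = τ + 1) :
    (↑(unitC hτ) ^ 2 : ℍ[F]).re = (τ - 1) / 2 ∧ (↑(unitC hτ) ^ 2 : ℍ[F]).imI = τ / 2 ∧
      (↑(unitC hτ) ^ 2 : ℍ[F]).imJ = 1 / 2 ∧ (↑(unitC hτ) ^ 2 : ℍ[F]).imK = 0 := by
  have h2 : (2 : F) ≠ 0 := NeZero.ne 2
  refine ⟨?_, ?_, ?_, ?_⟩ <;> simp [unitC, pow_two] <;> grind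

theorem unitW_sq_coords :
    (↑(unitW : unitary ℍ[F]) ^ 2 : ℍ[F]).re = -1 / 2 ∧
      (↑(unitW : unitary ℍ[F]) ^ 2 : ℍ[F]).imI = 1 / 2 ∧
      (↑(unitW : unitary ℍ[F]) ^ 2 : ℍ[F]).imJ = 1 / 2 ∧
      (↑(unitW : unitary ℍ[F]) ^ 2 : ℍ[F]).imK = 1 / 2 := by
  have h2 : (2 : F) ≠ 0 := NeZero.ne 2
  refine ⟨?_, ?_, ?_, ?_⟩ <;> simp [unitW, pow_two] <;> grind

set_option maxHeartbeats 1000000 in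
theorem icosahedralRelations_map_unit (hτ : τ ^ 2 = τ + 1) {G : Type*} [Group G]
    (φ : unitary ℍ[F] →* G) (hφ : φ (-1) = 1) :
    IcosahedralRelations (φ (unitC hτ)) (φ unitI) (φ unitJ) (φ unitW) := by
  have h2 : (2 : F) ≠ 0 := NeZero.ne 2
  have eq {x y : unitary ℍ[F]} (h : x = y ∨ x = -y) : φ x = φ y := by
    rcases h with rfl | rfl
    · rfl
    · rw [← neg_one_mul, map_mul, hφ, one_mul]
  obtain ⟨c0, c1, c2, c3⟩ := unitC_sq_coords hτ
  obtain ⟨w0, w1, w2, w3⟩ := unitW_sq_coords (F := F)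
  have c4 : (unitC hτ : ℍ[F]) ^ 4 = unitC hτ ^ 2 * unitC hτ ^ 2 := by rw [← pow_add]
  constructor <;> simp only [← map_mul, ← map_pow, ← φ.map_one] <;> apply eq
  case c_pow =>
    right
    rw [pow_succ]
    ext <;> simp [c0, c1, c2, c3, c4, Unitary.coe_neg] <;> simp [unitC] <;>
      clear c0 c1 c2 c3 c4 w0 w1 w2 w3 <;> grind
  case w_pow =>
    right
    rw [pow_succ]
    ext <;> simp [w0, w1, w2, w3, Unitary.coe_neg] <;> simp [unitW] <;>
      clear c0 c1 c2 c3 c4 w0 w1 w2 w3 <;> grind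
  case i_sq | j_sq | ij =>
    right
    ext <;> simp [unitI, unitJ, pow_two, Unitary.coe_neg]
  case wc | wc2 =>
    right
    ext <;> simp [c0, c1, c2, c3, c4, w0, w1, w2, w3, Unitary.coe_neg] <;>
      simp [unitC, unitW, unitI] <;> clear c0 c1 c2 c3 c4 w0 w1 w2 w3 <;> grind
  case wi | wj =>
    left
    ext <;> simp [unitW, unitI, unitJ]
  case wc3 | wc4 =>
    left
    ext <;> simp [pow_succ _ 2, c0, c1, c2, c3, c4] <;> simp [unitC, unitW, unitI, unitJ] <;>
      clear c0 c1 c2 c3 c4 w0 w1 w2 w3 <;> grind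

theorem unitaryConj_unitC (hτ : τ ^ 2 = τ + 1) (h : τ + 2 ≠ 0) :
    unitaryConj (conjUnit hτ h) (unitC hτ) = unitC hτ := by
  have h2 : (2 : F) ≠ 0 := NeZero.ne 2
  apply Subtype.ext
  change (conjUnit hτ h : ℍ[F]) * _ * ↑(conjUnit hτ h)⁻¹ = _
  rw [Units.mul_inv_eq_iff_eq_mul]
  ext <;> simp [unitC, coe_conjUnit] <;> grind

theorem unitaryToPSL_unitI_mul_unitJ_ne_one {a b : F} (hab : a ^ 2 + b ^ 2 = -1) :
    unitaryToPSL hab (unitI * unitJ) ≠ 1 := by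
  have h2 : (2 : F) ≠ 0 := NeZero.ne 2
  intro h
  rw [← map_one (unitaryToPSL hab)] at h
  obtain ⟨r, hr⟩ := exists_smul_eq_of_unitaryToPSL_eq hab h.symm
  have h00 := congrFun₂ hr 0 0
  have h01 := congrFun₂ hr 0 1
  have h11 := congrFun₂ hr 1 1
  simp [splitMatrix, unitI, unitJ] at h00 h01 h11
  grind

theorem unitaryToPSL_unitJ_ne (hτ : τ ^ 2 = τ + 1) (h : τ + 2 ≠ 0) {a b : F}
    (hab : a ^ 2 + b ^ 2 = -1) :
    unitaryToPSL hab unitJ ≠ unitaryToPSL hab (unitaryConj (conjUnit hτ h) unitJ) := by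
  have h2 : (2 : F) ≠ 0 := NeZero.ne 2
  intro hJ
  obtain ⟨r, hr⟩ := exists_smul_eq_of_unitaryToPSL_eq hab hJ
  have hr' := congrArg (· * splitMatrix a b (conjUnit hτ h)) hr
  simp only [Matrix.smul_mul, ← splitMatrix_mul hab] at hr'
  change splitMatrix a b ((conjUnit hτ h : ℍ[F]) * _ * ↑(conjUnit hτ h)⁻¹ * _) = _ at hr'
  rw [Units.inv_mul_cancel_right] at hr'
  have h00 := congrFun₂ hr' 0 0
  have h01 := congrFun₂ hr' 0 1
  have h10 := congrFun₂ hr' 1 0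
  have h11 := congrFun₂ hr' 1 1
  simp [splitMatrix, coe_conjUnit, unitJ] at h00 h01 h10 h11
  have hr1 : r = 1 := by
    apply mul_left_cancel₀ h2
    linear_combination h00 + h11
  rw [hr1] at h00 h01
  have hb : b = 0 := by
    have : 2 * (τ * b) = 0 := by linear_combination -h00
    grind
  have ha : a = 0 := by
    have : 2 * (τ * a) = 0 := by linear_combination h01
    grind
  simp [ha, hb] at hab

theorem exists_A5_inf_mulEquiv_dihedralGroup (hτ : τ ^ 2 = τ + 1) (h : τ + 2 ≠ 0) {a b : F}
    (hab : a ^ 2 + b ^ 2 = -1) :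
    ∃ H K : Subgroup (Matrix.ProjectiveSpecialLinearGroup (Fin 2) F), H ≠ K ∧
      Nonempty (H ≃* alternatingGroup (Fin 5)) ∧
      Nonempty (K ≃* alternatingGroup (Fin 5)) ∧
      Nonempty ((H ⊓ K : Subgroup (Matrix.ProjectiveSpecialLinearGroup (Fin 2) F)) ≃*
        DihedralGroup 5) := by
  have hneg := unitaryToPSL_neg_one hab
  have hconj : unitaryConj (conjUnit hτ h) (-1) = -1 := by
    apply Subtype.ext
    change (conjUnit hτ h : ℍ[F]) * ↑(-1 : unitary ℍ[F]) * ↑(conjUnit hτ h)⁻¹ = _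
    rw [Unitary.coe_neg]
    simp
  obtain ⟨φ, φc, φi, φj⟩ := exists_hom_of_icosahedralRelations
    (icosahedralRelations_map_unit hτ (unitaryToPSL hab) hneg)
  obtain ⟨ψ, ψc, ψi, ψj⟩ := exists_hom_of_icosahedralRelations (icosahedralRelations_map_unit hτ
    ((unitaryToPSL hab).comp (unitaryConj (conjUnit hτ h)))
    (by rw [MonoidHom.comp_apply, hconj, hneg]))
  refine ⟨φ.range, ψ.range, range_ne_and_inf_range_mulEquiv ?_ ?_ ?_ ?_⟩
  · rw [φc, ψc, MonoidHom.comp_apply, unitaryConj_unitC]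
  · rw [map_mul, map_mul, φi, φj, ψi, ψj, ← map_mul, ← map_mul, MonoidHom.comp_apply,
      unitaryConj_unitI_mul_unitJ, map_mul _ (-1), hneg, one_mul]
  · rw [map_mul, φi, φj, ← map_mul]
    exact unitaryToPSL_unitI_mul_unitJ_ne_one hab
  · rw [φj, ψj]
    exact unitaryToPSL_unitJ_ne hτ h hab

end

end Quaternion

theorem ZMod.isSquare_five {p : ℕ} [Fact p.Prime] (hp : p ≠ 2)
    (h : p % 10 = 1 ∨ p % 10 = 9) : IsSquare (5 : ZMod p) := by
  have : Fact (Nat.Prime 5) := ⟨by norm_num⟩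
  refine (ZMod.exists_sq_eq_prime_iff_of_mod_four_eq_one (p := 5) (q := p) (by norm_num) hp).1 ?_
  have h5 : p % 5 = 1 ∨ p % 5 = 4 := by omega
  rw [← ZMod.natCast_mod]
  rcases h5 with h5 | h5 <;> rw [h5]
  · exact ⟨1, by norm_num⟩
  · exact ⟨2, by norm_num⟩

theorem psl_two_A5_intersect_in_D10 (p : ℕ) [Fact p.Prime] (hp : 5 < p)
    (h10 : p % 10 = 1 ∨ p % 10 = 9) :
    ∃ H K : Subgroup (PSL p), H ≠ K ∧
      Nonempty (H ≃* alternatingGroup (Fin 5)) ∧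
      Nonempty (K ≃* alternatingGroup (Fin 5)) ∧
      Nonempty ((H ⊓ K : Subgroup (PSL p)) ≃* DihedralGroup 5) := by
  have hp2 : p ≠ 2 := by omega
  have two_ne : (2 : ZMod p) ≠ 0 := by
    intro h
    have : ((2 : ℕ) : ZMod p) = 0 := by exact_mod_cast h
    exact absurd (Nat.le_of_dvd (by norm_num) ((ZMod.natCast_eq_zero_iff _ _).1 this)) (by omega)
  have five_ne : (5 : ZMod p) ≠ 0 := by
    intro h
    have : ((5 : ℕ) : ZMod p) = 0 := by exact_mod_cast h
    exact absurd (Nat.le_of_dvd (by norm_num) ((ZMod.natCast_eq_zero_iff _ _).1 this)) (by omega)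
  have : NeZero (2 : ZMod p) := ⟨two_ne⟩
  obtain ⟨s, hs⟩ := ZMod.isSquare_five hp2 h10
  obtain ⟨a, b, hab⟩ := ZMod.sq_add_sq p (-1)
  have hτ : ((1 + s) / 2) ^ 2 = (1 + s) / 2 + 1 := by
    field_simp
    linear_combination -hs
  refine exists_A5_inf_mulEquiv_dihedralGroup hτ (fun h ↦ five_ne ?_) hab
  linear_combination (3 - (1 + s) / 2) * h + hτ
end
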